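/- arXiv:1804.01616 — 3 statements merged into one kernel-verified Lean document; each statement's English description precedes it below -/
import Mathlib

section
/- The number of classical parking functions of length n is (n+1)^(n-1). -/
/-- `s ∈ [n]^n` is a classical parking function: for every `k ∈ [n]`, at least `k`
entries are `≤ k` (0-indexed via `Fin n`). -/
def IsParkingFunction {n : ℕ} (s : Fin n → Fin n) : Prop :=
  ∀ k : Fin n, (k : ℕ) + 1 ≤ (Finset.univ.filter fun i => s i ≤ k).card

instance {n : ℕ} : DecidablePred (IsParkingFunction (n := n)) := fun _ => by
  unfold IsParkingFunction; infer_instance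

/-- Number of entries of `f` with value `< m`. -/
def cntLt {n : ℕ} (f : Fin n → Fin (n + 1)) (m : ℕ) : ℕ :=
  (Finset.univ.filter fun i => (f i : ℕ) < m).card

/-- Parking condition for functions into `Fin (n+1)`. -/
def ParkQ {n : ℕ} (g : Fin n → Fin (n + 1)) : Prop :=
  ∀ k : ℕ, k ≤ n → k ≤ cntLt g k

lemma val_sub_cases {n : ℕ} (a b : Fin (n + 1)) :
    (b.val ≤ a.val ∧ (a - b).val + b.val = a.val) ∨
      (a.val < b.val ∧ (a - b).val + b.val = a.val + (n + 1)) := by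
  have ha := a.isLt
  have hb := b.isLt
  rcases le_or_gt b.val a.val with h | h
  · left
    refine ⟨h, ?_⟩
    rw [Fin.sub_def]
    have : (n + 1 - b.val + a.val) % (n + 1) = a.val - b.val := by
      rw [show n + 1 - b.val + a.val = (a.val - b.val) + (n + 1) by omega, Nat.add_mod_right,
        Nat.mod_eq_of_lt (by omega)]
    simp only [this]
    omega
  · right
    refine ⟨h, ?_⟩
    rw [Fin.sub_def]
    have : (n + 1 - b.val + a.val) % (n + 1) = n + 1 - b.val + a.val :=
      Nat.mod_eq_of_lt (by omega)
    simp only [this]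
    omega

lemma cnt_one {n : ℕ} (f : Fin n → Fin (n + 1)) (t : Fin (n + 1)) (u : ℕ)
    (h : t.val ≤ u) (hu : u ≤ n + 1) :
    cntLt (fun i => f i - t) (u - t.val) + cntLt f t.val = cntLt f u := by
  unfold cntLt
  simp only [Finset.card_filter]
  rw [← Finset.sum_add_distrib]
  refine Finset.sum_congr rfl fun i _ => ?_
  have := val_sub_cases (f i) t
  have := (f i).isLt
  split_ifs <;> omega

lemma cnt_two {n : ℕ} (f : Fin n → Fin (n + 1)) (t : Fin (n + 1)) (u : ℕ)
    (h : u < t.val) :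
    cntLt (fun i => f i - t) (u + (n + 1) - t.val) + cntLt f t.val = cntLt f u + n := by
  have hn : n = ∑ i : Fin n, 1 := by simp
  unfold cntLt
  simp only [Finset.card_filter]
  conv_rhs => rw [add_comm]; arg 1; rw [hn]
  rw [← Finset.sum_add_distrib, ← Finset.sum_add_distrib]
  refine Finset.sum_congr rfl fun i _ => ?_
  have := val_sub_cases (f i) t
  have := (f i).isLt
  have := t.isLt
  split_ifs <;> omega

lemma parkQ_sub_iff {n : ℕ} (f : Fin n → Fin (n + 1)) (t : Fin (n + 1)) :
    ParkQ (fun i => f i - t) ↔ ∀ u : ℕ, u ≤ n →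
      (t.val ≤ u → cntLt f t.val + u ≤ cntLt f u + t.val) ∧
      (u < t.val → cntLt f t.val + u < cntLt f u + t.val) := by
  have ht := t.isLt
  constructor
  · intro h u hu
    constructor
    · intro htu
      have h1 := cnt_one f t u htu (by omega)
      have h2 := h (u - t.val) (by omega)
      omega
    · intro htu
      have h1 := cnt_two f t u htu
      have h2 := h (u + (n + 1) - t.val) (by omega)
      omega
  · intro h k hk
    rcases le_or_gt (t.val + k) n with h1 | h1
    · have h2 := cnt_one f t (t.val + k) (by omega) (by omega)
      have h3 := (h (t.val + k) h1).1 (by omega)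
      rw [show t.val + k - t.val = k by omega] at h2
      omega
    · have h2 := cnt_two f t (t.val + k - (n + 1)) (by omega)
      have h3 := (h (t.val + k - (n + 1)) (by omega)).2 (by omega)
      rw [show t.val + k - (n + 1) + (n + 1) - t.val = k by omega] at h2
      omega

lemma parkQ_unique {n : ℕ} (f : Fin n → Fin (n + 1)) (t t' : Fin (n + 1))
    (h : ParkQ (fun i => f i - t)) (h' : ParkQ (fun i => f i - t')) : t = t' := by
  rw [parkQ_sub_iff] at h h'
  have h1 := h t'.val (by omega)
  have h2 := h' t.val (by omega)
  apply Fin.ext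
  omega

lemma parkQ_exists {n : ℕ} (f : Fin n → Fin (n + 1)) :
    ∃ t : Fin (n + 1), ParkQ (fun i => f i - t) := by
  obtain ⟨t, ht⟩ := Finite.exists_min (fun t : Fin (n + 1) =>
    ((cntLt f t.val : ℤ) - t.val) * (n + 1) + t.val)
  refine ⟨t, (parkQ_sub_iff f t).2 fun u hu => ?_⟩
  have h := ht ⟨u, by omega⟩
  simp only at h
  have htn : (t.val : ℤ) ≤ n := by have := t.isLt; omega
  have hun : (u : ℤ) ≤ n := by omega
  constructor
  · intro h1
    by_contra h2
    have h3 : (cntLt f u : ℤ) - u + 1 ≤ (cntLt f t.val : ℤ) - t.val := by omega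
    nlinarith
  · intro h1
    by_contra h2
    have h3 : (cntLt f u : ℤ) - u ≤ (cntLt f t.val : ℤ) - t.val := by omega
    have h4 : (u : ℤ) < t.val := by exact_mod_cast h1
    nlinarith

lemma parkQ_castSucc {n : ℕ} (s : Fin n → Fin n) :
    ParkQ (fun i => (s i).castSucc) ↔ IsParkingFunction s := by
  unfold ParkQ IsParkingFunction cntLt
  constructor
  · intro h k
    have := h (k.val + 1) (by omega)
    simpa only [Nat.lt_succ_iff, Fin.le_def, Fin.val_castSucc] using this
  · intro h k hk
    rcases k with _ | k
    · simp
    · have := h ⟨k, by omega⟩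
      simpa only [Nat.lt_succ_iff, Fin.le_def, Fin.val_castSucc] using this

lemma parkQ_lt {n : ℕ} (g : Fin n → Fin (n + 1)) (h : ParkQ g) (i : Fin n) :
    (g i).val < n := by
  have h1 := h n le_rfl
  unfold cntLt at h1
  have h2 : (Finset.univ.filter fun i => (g i : ℕ) < n) = Finset.univ := by
    apply Finset.eq_univ_of_card
    apply le_antisymm (Finset.card_le_univ _)
    simpa using h1
  have : i ∈ (Finset.univ.filter fun i => (g i : ℕ) < n) := by rw [h2]; simp
  simpa using this

lemma park_bij (n : ℕ) : Function.Bijective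
    (fun p : {s : Fin n → Fin n // IsParkingFunction s} × Fin (n + 1) =>
      (fun i => (p.1.1 i).castSucc + p.2 : Fin n → Fin (n + 1))) := by
  constructor
  · rintro ⟨⟨s, hs⟩, t⟩ ⟨⟨s', hs'⟩, t'⟩ h
    simp only at h
    have e : t = t' := by
      apply parkQ_unique (fun i => (s i).castSucc + t)
      · simpa [parkQ_castSucc] using hs
      · simp only [fun i => congrFun h i]
        simpa [parkQ_castSucc] using hs'
    subst e
    congr 2
    funext i
    have := congrFun h i
    simpa using this
  · intro f
    obtain ⟨t, ht⟩ := parkQ_exists f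
    have hl := parkQ_lt _ ht
    have e : ∀ i, (Fin.castSucc ⟨(f i - t).val, hl i⟩ : Fin (n + 1)) = f i - t :=
      fun i => Fin.ext rfl
    refine ⟨⟨⟨fun i => ⟨(f i - t).val, hl i⟩, ?_⟩, t⟩, ?_⟩
    · rw [← parkQ_castSucc]
      exact ht
    · funext i
      simp only [e, sub_add_cancel]

/-- The number of classical parking functions of length `n`
is `(n+1)^(n-1)`. -/
theorem card_parking_functions (n : ℕ) :
    Fintype.card {s : Fin n → Fin n // IsParkingFunction s} = (n + 1) ^ (n - 1) := by
  have h := Fintype.card_of_bijective (park_bij n)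
  rw [Fintype.card_prod, Fintype.card_fun, Fintype.card_fin, Fintype.card_fin] at h
  rcases n with _ | n
  · simpa using h
  · rw [pow_succ] at h
    exact Nat.eq_of_mul_eq_mul_right (Nat.succ_pos _) h
end

section
/- The total number of pairs (T,p), where T is a rooted tree on vertex set [n] (edges oriented toward the root) and p ∈ [n]^n is a prime parking function on T, equals (2n−2)! for every n ≥ 1. -/
/-! Rooted trees on vertex set `Fin n`, edges oriented towards the root: encoded by
the root and the parent function (`parent v` is the endpoint of the unique outgoing
edge of a non-root vertex `v`; the root is a fixed point). Tree-ness is the condition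
that every vertex reaches the root by iterating `parent` (fewer than `n` steps
always suffice). -/

/-- `(root, parent)` encodes a rooted tree on `Fin n` with edges oriented toward the
root. -/
def IsRootedTree {n : ℕ} (root : Fin n) (parent : Fin n → Fin n) : Prop :=
  parent root = root ∧ ∀ v, ∃ k ∈ Finset.range n, parent^[k] v = root

/-- `T_v`: the set of vertices `u` with a directed path from `u` to `v`
(including `v` itself). -/
def subtree {n : ℕ} (parent : Fin n → Fin n) (v : Fin n) : Finset (Fin n) :=
  Finset.univ.filter fun u => ∃ k ∈ Finset.range n, parent^[k] u = v

/-- The directed path from `v` towards the root: `v, parent v, parent² v, …`. -/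
def pathToRoot {n : ℕ} (parent : Fin n → Fin n) (v : Fin n) : List (Fin n) :=
  (List.range n).map fun k => parent^[k] v

/-- The spot where a driver preferring `v` parks, given the set `occ` of occupied
vertices: the first unoccupied vertex on the path from `v` to the root (`none` if
there is no such vertex, i.e. the driver leaves without parking). -/
def parkSpot {n : ℕ} (parent : Fin n → Fin n) (occ : Finset (Fin n)) (v : Fin n) :
    Option (Fin n) :=
  (pathToRoot parent v).find? fun u => decide (u ∉ occ)

/-- The effect of one driver (preferring `v`) parking on the occupied set. -/
def treeStep {n : ℕ} (parent : Fin n → Fin n) (occ : Finset (Fin n)) (v : Fin n) :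
    Finset (Fin n) :=
  match parkSpot parent occ v with
  | some u => insert u occ
  | none => occ

/-- The set of occupied vertices after the first `m` drivers (with preference
sequence `s`) have attempted to park, in order. -/
def occAfter {n : ℕ} (parent : Fin n → Fin n) (s : Fin n → Fin n) (m : ℕ) :
    Finset (Fin n) :=
  ((List.ofFn s).take m).foldl (treeStep parent) ∅

/-- `s` is a parking function on the rooted tree `(root, parent)`: all `n` drivers
successfully park. -/
def IsTreePF {n : ℕ} (parent : Fin n → Fin n) (s : Fin n → Fin n) : Prop :=
  occAfter parent s n = Finset.univ

/-- `s` is a prime parking function on `(root, parent)`: it is a parking function and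
for every non-root vertex `v`, `|T_v| < |{i : s_i ∈ T_v}|`. -/
def IsPrimeTreePF {n : ℕ} (root : Fin n) (parent : Fin n → Fin n)
    (s : Fin n → Fin n) : Prop :=
  IsTreePF parent s ∧ ∀ v, v ≠ root →
    (subtree parent v).card < (Finset.univ.filter fun i => s i ∈ subtree parent v).card

/-- The edge `(u, parent u)` (for non-root `u`) is *used* by `s`: some driver `i`,
after failing to park at her preferred spot `s i`, crosses it, i.e. every vertex on
the path from `s i` up to and including `u` is occupied when she drives. -/
def UsedEdge {n : ℕ} (root : Fin n) (parent : Fin n → Fin n) (s : Fin n → Fin n)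
    (u : Fin n) : Prop :=
  u ≠ root ∧ ∃ i : Fin n, ∃ k, parent^[k] (s i) = u ∧
    ∀ j ≤ k, parent^[j] (s i) ∈ occAfter parent s i

instance {n : ℕ} (root : Fin n) (parent : Fin n → Fin n) :
    Decidable (IsRootedTree root parent) := by unfold IsRootedTree; infer_instance

instance {n : ℕ} (parent s : Fin n → Fin n) : Decidable (IsTreePF parent s) := by
  unfold IsTreePF; infer_instance

instance {n : ℕ} (root : Fin n) (parent s : Fin n → Fin n) :
    Decidable (IsPrimeTreePF root parent s) := by unfold IsPrimeTreePF; infer_instance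


namespace PrimePark
open PowerSeries Finset

/-- The shifted Catalan series `K = t C(t)`, satisfying `K = t + K²`. -/
noncomputable def catK : PowerSeries ℚ := PowerSeries.X * PowerSeries.mk fun n => (catalan n : ℚ)

lemma catK_eq : (1 - catK) * catK = PowerSeries.X := by
  have h : (PowerSeries.mk fun n => (catalan n : ℚ)) =
      1 + PowerSeries.X * ((PowerSeries.mk fun n => (catalan n : ℚ)) *
        (PowerSeries.mk fun n => (catalan n : ℚ))) := by
    ext n
    cases n with
    | zero => simp
    | succ n =>
      rw [map_add, PowerSeries.coeff_succ_X_mul, PowerSeries.coeff_mul]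
      simp [PowerSeries.coeff_one, catalan_succ']
  unfold catK
  generalize (PowerSeries.mk fun n => (catalan n : ℚ)) = c at *
  linear_combination (X : PowerSeries ℚ) * h

/-- Evaluate a power series in `Y` over `ℚ⟦t⟧` at `Y = K`. -/
noncomputable def evK (G : PowerSeries (PowerSeries ℚ)) : PowerSeries ℚ :=
  PowerSeries.mk fun k => coeff k ((trunc (k + 1) G).eval catK)

lemma X_pow_dvd_eval (M : ℕ) (q : Polynomial (PowerSeries ℚ))
    (h : ∀ d < M, q.coeff d = 0) : (X : PowerSeries ℚ) ^ M ∣ q.eval catK := by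
  obtain ⟨r, rfl⟩ := Polynomial.X_pow_dvd_iff.2 h
  rw [Polynomial.eval_mul, Polynomial.eval_pow, Polynomial.eval_X]
  exact Dvd.dvd.mul_right (pow_dvd_pow_of_dvd ⟨_, rfl⟩ M) _

lemma coeff_evK (G : PowerSeries (PowerSeries ℚ)) (k M : ℕ) (h : k < M) :
    coeff k (evK G) = coeff k ((trunc M G).eval catK) := by
  have := X_pow_dvd_eval (k + 1) (trunc M G - trunc (k + 1) G) (by
    intro d hd
    rw [Polynomial.coeff_sub, coeff_trunc, coeff_trunc, if_pos hd, if_pos (by omega), sub_self])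
  have := PowerSeries.X_pow_dvd_iff.1 this k (by omega)
  rw [Polynomial.eval_sub, map_sub, sub_eq_zero] at this
  rw [this, evK, coeff_mk]

lemma evK_add (G H : PowerSeries (PowerSeries ℚ)) : evK (G + H) = evK G + evK H := by
  ext k
  simp [evK]

lemma evK_mul (G H : PowerSeries (PowerSeries ℚ)) : evK (G * H) = evK G * evK H := by
  ext k
  have h1 := X_pow_dvd_eval (k + 1) (trunc (k + 1) (G * H) - trunc (k + 1) G * trunc (k + 1) H) (by
    intro d hd
    rw [Polynomial.coeff_sub, coeff_trunc, if_pos hd, coeff_mul_eq_coeff_trunc_mul_trunc _ _ hd]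
    rw [← Polynomial.coe_mul, Polynomial.coeff_coe, sub_self])
  have h1 := PowerSeries.X_pow_dvd_iff.1 h1 k (by omega)
  rw [Polynomial.eval_sub, map_sub, sub_eq_zero, Polynomial.eval_mul] at h1
  rw [coeff_evK _ k (k+1) (by omega), h1, PowerSeries.coeff_mul, PowerSeries.coeff_mul]
  refine Finset.sum_congr rfl fun x hx => ?_
  have := Finset.HasAntidiagonal.mem_antidiagonal.1 hx
  rw [coeff_evK G x.1 (k+1) (by omega), coeff_evK H x.2 (k+1) (by omega)]

lemma evK_X : evK X = catK := by
  ext k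
  rw [coeff_evK _ k (k+2) (by omega), trunc_X, Polynomial.eval_X]

lemma evK_C (r : PowerSeries ℚ) : evK (C r) = r := by
  ext k
  rw [coeff_evK _ k (k+1) (by omega), trunc_C, Polynomial.eval_C]

lemma constantCoeff_evK (G : PowerSeries (PowerSeries ℚ)) (h : coeff 0 G = 0) :
    coeff 0 (evK G) = 0 := by
  rw [coeff_evK _ 0 1 (by omega), trunc_one_left, h]
  simp

/-- Series in `ℚ[X]⟦Y⟧` of an array supported on `n ≤ m + 1`. -/
noncomputable def arr (a : ℕ → ℕ → ℚ) : PowerSeries (Polynomial ℚ) :=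
  PowerSeries.mk fun m => ∑ n ∈ range (m + 2), Polynomial.monomial n (a n m)

lemma arr_coeff (a : ℕ → ℕ → ℚ) (h : ∀ n m, m + 1 < n → a n m = 0) (n m : ℕ) :
    (coeff m (arr a)).coeff n = a n m := by
  rw [arr, coeff_mk, Polynomial.finsetSum_coeff]
  simp only [Polynomial.coeff_monomial]
  rw [Finset.sum_ite_eq']
  split_ifs with h1
  · rfl
  · rw [h]
    simp at h1
    omega

/-- The evaluation `X ↦ 1 - K`, `Y ↦ K`. -/
noncomputable def ev (G : PowerSeries (Polynomial ℚ)) : PowerSeries ℚ :=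
  evK (PowerSeries.map (Polynomial.aeval (1 - catK)).toRingHom G)

lemma ev_add (G H) : ev (G + H) = ev G + ev H := by simp [ev, evK_add]
lemma ev_mul (G H) : ev (G * H) = ev G * ev H := by simp [ev, evK_mul]
lemma ev_X : ev X = catK := by simp [ev, evK_X]
lemma ev_CX : ev (C Polynomial.X) = 1 - catK := by
  rw [ev, PowerSeries.map_C, evK_C]; simp

lemma ev_diag (a : ℕ → ℚ) :
    ev (arr fun n m => if n = m then a n else 0) = PowerSeries.mk a := by
  have h : arr (fun n m => if n = m then a n else 0) =
      PowerSeries.mk fun m => Polynomial.monomial m (a m) := by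
    ext m n
    rw [arr_coeff _ (by intro n m h; rw [if_neg (by omega)]), coeff_mk, Polynomial.coeff_monomial]
    by_cases h : n = m
    · subst h; simp
    · rw [if_neg h, if_neg (Ne.symm h)]
  ext k
  rw [h, ev, coeff_evK _ k (k+1) (by omega), Polynomial.eval, eval₂_trunc_eq_sum_range]
  rw [map_sum, Finset.sum_eq_single k]
  · simp [Polynomial.aeval_monomial]
    rw [mul_assoc, ← mul_pow, catK_eq]
    simp [PowerSeries.coeff_X_pow]
  · intro b hb hbk
    simp [Polynomial.aeval_monomial]
    rw [mul_assoc, ← mul_pow, catK_eq]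
    simp [PowerSeries.coeff_X_pow, hbk.symm]
  · simp

theorem series_main (a : ℕ → ℕ → ℚ) (h10 : a 1 0 = 1)
    (hs : ∀ n m, a n m ≠ 0 → n ≤ m ∨ (n = 1 ∧ m = 0))
    (h1 : ∀ n m : ℕ, (n : ℚ) * a n m = a n m + ∑ j ∈ HasAntidiagonal.antidiagonal m, ∑ i ∈ HasAntidiagonal.antidiagonal n,
      a i.1 j.1 * (if i.2 < j.2 then (i.2 : ℚ) * a i.2 j.2 else 0))
    (h2 : ∀ n m : ℕ, (m : ℚ) * a n m = (if m = 0 then 0 else a n (m - 1)) +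
      ∑ j ∈ HasAntidiagonal.antidiagonal m, ∑ i ∈ HasAntidiagonal.antidiagonal n,
      a i.1 j.1 * (if i.2 < j.2 then (j.2 : ℚ) * a i.2 j.2 else 0)) (n : ℕ) :
    ((n + 1 : ℕ) : ℚ) * a (n + 1) (n + 1) = catalan n := by
  have hs' : ∀ n m, m + 1 < n → a n m = 0 := by
    intro n m h
    by_contra h'
    have := hs n m h'
    omega
  set p : ℕ → ℕ → ℚ := fun n m => if n < m then (n : ℚ) * a n m else 0 with hp
  set q : ℕ → ℕ → ℚ := fun n m => if n < m then (m : ℚ) * a n m else 0 with hq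
  set θ : ℕ → ℕ → ℚ := fun n m => if n = m then (n : ℚ) * a n n else 0 with hθ
  have hps : ∀ n m, m + 1 < n → p n m = 0 := by
    intro n m h; simp only [hp]; rw [if_neg (by omega)]
  have hqs : ∀ n m, m + 1 < n → q n m = 0 := by
    intro n m h; simp only [hq]; rw [if_neg (by omega)]
  have hθs : ∀ n m, m + 1 < n → θ n m = 0 := by
    intro n m h; simp only [hθ]; rw [if_neg (by omega)]
  have E1 : arr p + C Polynomial.X + arr θ = arr a + arr a * arr p := by
    ext m n
    simp only [map_add, Polynomial.coeff_add, coeff_mul, Polynomial.finsetSum_coeff,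
      Polynomial.coeff_mul, arr_coeff _ hps, arr_coeff _ hs', arr_coeff _ hθs]
    rw [← h1 n m]
    simp only [hp, hθ, PowerSeries.coeff_C]
    rcases lt_trichotomy n m with h | h | h
    · rw [if_pos h, if_neg (by omega), if_neg (by omega)]; simp
    · subst h
      rw [if_neg (by omega), if_pos rfl]
      by_cases h0 : n = 0
      · subst h0; simp
      · simp [h0]
    · rw [if_neg (by omega), if_neg (by omega : ¬ n = m)]
      by_cases h0 : n = 1 ∧ m = 0
      · obtain ⟨rfl, rfl⟩ := h0; simp [h10]
      · have : a n m = 0 := by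
          by_contra h'
          have := hs n m h'
          omega
        rw [this]
        by_cases hm : m = 0
        · have : ¬ 1 = n := by omega
          simp [hm, Polynomial.coeff_X, this]
        · simp [hm]
  have E2 : arr q + arr θ = X * arr a + arr a * arr q := by
    ext m n
    have hX : (coeff m (X * arr a)).coeff n = if m = 0 then 0 else a n (m - 1) := by
      cases m with
      | zero => simp
      | succ m => rw [coeff_succ_X_mul, arr_coeff _ hs']; simp
    rw [map_add, map_add, Polynomial.coeff_add, Polynomial.coeff_add, hX, coeff_mul]
    simp only [Polynomial.finsetSum_coeff,
      Polynomial.coeff_mul, arr_coeff _ hqs, arr_coeff _ hs', arr_coeff _ hθs]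
    rw [← h2 n m]
    simp only [hq, hθ]
    rcases lt_trichotomy n m with h | h | h
    · rw [if_pos h, if_neg (by omega)]; simp
    · subst h
      rw [if_neg (by omega), if_pos rfl]; simp
    · rw [if_neg (by omega), if_neg (by omega : ¬ n = m)]
      by_cases hm : m = 0
      · simp [hm]
      · have : a n m = 0 := by
          by_contra h'
          have := hs n m h'
          omega
        simp [this]
  have E1' := congrArg ev E1
  have E2' := congrArg ev E2
  simp only [ev_add, ev_mul, ev_X, ev_CX] at E1' E2'
  have hP0 : coeff 0 (ev (arr p)) = 0 := by
    apply constantCoeff_evK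
    rw [coeff_map]
    simp [arr, hp]
  have hQ0 : coeff 0 (ev (arr q)) = 0 := by
    apply constantCoeff_evK
    rw [coeff_map]
    have : (coeff 0 (arr q)) = 0 := by simp [arr, hq]
    rw [this]; simp
  have hT := ev_diag (fun n => (n : ℚ) * a n n)
  change ev (arr θ) = _ at hT
  have hprod : (1 - ev (arr a)) * (ev (arr p) - ev (arr q) + 1 - catK) = 0 := by
    linear_combination E1' - E2'
  have hne : ev (arr p) - ev (arr q) + 1 - catK ≠ 0 := by
    intro h
    have := congrArg (coeff 0) h
    simp only [map_sub, map_add, hP0, hQ0] at this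
    simp [catK] at this
  have hf := (mul_eq_zero.1 hprod).resolve_right hne
  have hθK : ev (arr θ) = catK := by
    linear_combination E2' - (ev (arr q) + catK) * hf
  rw [hT] at hθK
  have := congrArg (coeff (n + 1)) hθK
  rw [coeff_mk, catK, coeff_succ_X_mul, coeff_mk] at this
  exact this

end PrimePark

namespace PrimePark
open Finset

section Comb
variable {V V' V1 V2 D D' D1 D2 : Type}

/-- `v` is on the forward orbit of `u`. -/
def Below (par : V → V) (u v : V) : Prop := ∃ k, par^[k] u = v

lemma Below.refl (par : V → V) (u : V) : Below par u u := ⟨0, rfl⟩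

lemma Below.step {par : V → V} {u v : V} (h : Below par (par u) v) : Below par u v := by
  obtain ⟨k, hk⟩ := h
  exact ⟨k + 1, by rwa [Function.iterate_succ_apply]⟩

lemma Below.trans {par : V → V} {u v w : V} (h : Below par u v) (h' : Below par v w) :
    Below par u w := by
  obtain ⟨k, rfl⟩ := h
  obtain ⟨l, rfl⟩ := h'
  exact ⟨l + k, by rw [Function.iterate_add_apply]⟩

lemma Below.eq_or {par : V → V} {u v : V} (h : Below par u v) : u = v ∨ Below par (par u) v := by
  obtain ⟨k, hk⟩ := h
  cases k with
  | zero => exact Or.inl hk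
  | succ k => exact Or.inr ⟨k, by rwa [Function.iterate_succ_apply] at hk⟩

lemma Below.of_fixed {par : V → V} {u v : V} (hu : par u = u) (h : Below par u v) : u = v := by
  obtain ⟨k, hk⟩ := h
  rwa [Function.iterate_fixed hu] at hk

/-- Rooted tree with all non-root flows positive. -/
def Good (r : V) (par : V → V) (p : D → V) : Prop :=
  par r = r ∧ (∀ v, Below par v r) ∧
    ∀ v, v ≠ r → Nat.card {u // Below par u v} < Nat.card {i // Below par (p i) v}

abbrev Obj (V D : Type) := {x : V × (V → V) × (D → V) // Good x.1 x.2.1 x.2.2}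

/-- Number of structures. -/
noncomputable def NN (V D : Type) : ℕ := Nat.card (Obj V D)

lemma below_conj (e : V ≃ V') (par : V → V) (u v : V) :
    Below (Equiv.arrowCongr e e par) (e u) (e v) ↔ Below par u v := by
  have h : Function.Semiconj e par (Equiv.arrowCongr e e par) := by
    intro x; simp [Equiv.arrowCongr]
  unfold Below
  refine exists_congr fun k => ?_
  rw [← (h.iterate_right k).eq u]
  exact e.injective.eq_iff

lemma good_conj (e : V ≃ V') (h : D ≃ D') (r : V) (par : V → V) (p : D → V) :
    Good (e r) (Equiv.arrowCongr e e par) (Equiv.arrowCongr h e p) ↔ Good r par p := by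
  unfold Good
  refine and_congr ?_ (and_congr ?_ ?_)
  · simp [Equiv.arrowCongr]
  · rw [← e.forall_congr_right]
    simp only [below_conj]
  · rw [← e.forall_congr_right]
    refine forall_congr' fun v => imp_congr (by simp) ?_
    rw [Nat.card_congr (e.subtypeEquiv (p := fun u => Below par u v)
      (q := fun u => Below (Equiv.arrowCongr e e par) u (e v))
      fun u => (below_conj e par u v).symm)]
    rw [Nat.card_congr (h.subtypeEquiv (p := fun i => Below par (p i) v)
      (q := fun i => Below (Equiv.arrowCongr e e par) ((Equiv.arrowCongr h e p) i) (e v))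
      fun i => by
        have : Equiv.arrowCongr h e p (h i) = e (p i) := by simp [Equiv.arrowCongr]
        rw [this, below_conj])]

lemma NN_congr (e : V ≃ V') (h : D ≃ D') : NN V D = NN V' D' := by
  refine Nat.card_congr (Equiv.subtypeEquiv
    (Equiv.prodCongr e (Equiv.prodCongr (Equiv.arrowCongr e e) (Equiv.arrowCongr h e))) ?_)
  rintro ⟨r, par, p⟩
  exact (good_conj e h r par p).symm

/-- Structure with a marked child `c` of the root with prescribed subtree and drivers. -/
def Cond (S : V → Prop) (E : D → Prop) (r : V) (par : V → V) (p : D → V) (c : V) : Prop :=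
  Good r par p ∧ c ≠ r ∧ par c = r ∧ (∀ u, Below par u c ↔ S u) ∧ ∀ i, Below par (p i) c ↔ E i

abbrev CObj (S : V → Prop) (E : D → Prop) :=
  {x : V × (V → V) × (D → V) × V // Cond S E x.1 x.2.1 x.2.2.1 x.2.2.2}

lemma CObj_congr (e : V ≃ V') (h : D ≃ D') (S : V → Prop) (S' : V' → Prop) (E : D → Prop)
    (E' : D' → Prop) (hS : ∀ u, S u ↔ S' (e u)) (hE : ∀ i, E i ↔ E' (h i)) :
    Nat.card (CObj S E) = Nat.card (CObj S' E') := by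
  refine Nat.card_congr (Equiv.subtypeEquiv
    (Equiv.prodCongr e (Equiv.prodCongr (Equiv.arrowCongr e e)
      (Equiv.prodCongr (Equiv.arrowCongr h e) e))) ?_)
  rintro ⟨r, par, p, c⟩
  refine and_congr (good_conj e h r par p).symm (and_congr ?_ (and_congr ?_ (and_congr ?_ ?_)))
  · simp
  · simp [Equiv.arrowCongr]
  · rw [← e.forall_congr_right (q := fun u => _ ↔ S' u)]
    refine forall_congr' fun u => ?_
    rw [hS]
    exact iff_congr (below_conj e par u c).symm Iff.rfl
  · rw [← h.forall_congr_right (q := fun u => _ ↔ E' u)]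
    refine forall_congr' fun i => ?_
    rw [hE]
    have : Equiv.arrowCongr h e p (h i) = e (p i) := by simp [Equiv.arrowCongr]
    refine iff_congr ?_ Iff.rfl
    rw [← below_conj e, ← this]
    rfl

open Classical in
/-- Glued parent function. -/
noncomputable def glue (c : V1) (par1 : V1 → V1) (r : V2) (par2 : V2 → V2) :
    V1 ⊕ V2 → V1 ⊕ V2 :=
  Sum.elim (fun v => if v = c then Sum.inr r else Sum.inl (par1 v)) (fun v => Sum.inr (par2 v))

section Glue
variable {c : V1} {par1 : V1 → V1} {r : V2} {par2 : V2 → V2}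

lemma glue_inr (v : V2) : glue c par1 r par2 (Sum.inr v) = Sum.inr (par2 v) := rfl
lemma glue_c : glue c par1 r par2 (Sum.inl c) = Sum.inr r := by simp [glue]
lemma glue_inl {v : V1} (h : v ≠ c) : glue c par1 r par2 (Sum.inl v) = Sum.inl (par1 v) := by
  simp [glue, h]

lemma glue_iter_inr (k : ℕ) (u : V2) :
    (glue c par1 r par2)^[k] (Sum.inr u) = Sum.inr (par2^[k] u) := by
  induction k generalizing u with
  | zero => rfl
  | succ k ih => rw [Function.iterate_succ_apply, glue_inr, ih, Function.iterate_succ_apply]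

lemma below_rr (u v : V2) :
    Below (glue c par1 r par2) (Sum.inr u) (Sum.inr v) ↔ Below par2 u v := by
  simp [Below, glue_iter_inr]

lemma below_rl (u : V2) (v : V1) : ¬ Below (glue c par1 r par2) (Sum.inr u) (Sum.inl v) := by
  simp [Below, glue_iter_inr]

lemma below_ll (h1 : par1 c = c) (u v : V1) :
    Below (glue c par1 r par2) (Sum.inl u) (Sum.inl v) ↔ Below par1 u v := by
  constructor
  · rintro ⟨k, hk⟩
    induction k generalizing u with
    | zero =>
      obtain rfl : u = v := by simpa using hk
      exact Below.refl _ _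
    | succ k ih =>
      rw [Function.iterate_succ_apply] at hk
      by_cases h : u = c
      · subst h
        rw [glue_c] at hk
        exact absurd ⟨k, hk⟩ (below_rl _ _)
      · rw [glue_inl h] at hk
        exact (ih _ hk).step
  · rintro ⟨k, hk⟩
    induction k generalizing u with
    | zero =>
      obtain rfl : u = v := by simpa using hk
      exact Below.refl _ _
    | succ k ih =>
      rw [Function.iterate_succ_apply] at hk
      have := ih _ hk
      by_cases h : u = c
      · subst h
        rwa [h1] at this
      · apply Below.step
        rwa [glue_inl h]

lemma below_lr (h2 : par2 r = r) (u : V1) (v : V2)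
    (h : Below (glue c par1 r par2) (Sum.inl u) (Sum.inr v)) : r = v := by
  obtain ⟨k, hk⟩ := h
  induction k generalizing u with
  | zero => simp at hk
  | succ k ih =>
    rw [Function.iterate_succ_apply] at hk
    by_cases h : u = c
    · subst h
      rw [glue_c] at hk
      exact Below.of_fixed h2 ((below_rr _ _).1 ⟨k, hk⟩)
    · rw [glue_inl h] at hk
      exact ih _ hk

lemma card_sum_left (P : V1 ⊕ V2 → Prop) (Q : V1 → Prop) (h : ∀ v, P (Sum.inl v) ↔ Q v)
    (h' : ∀ v, ¬ P (Sum.inr v)) : Nat.card {x // P x} = Nat.card {x // Q x} := by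
  symm
  refine Nat.card_eq_of_bijective (fun x => ⟨Sum.inl x.1, (h _).2 x.2⟩) ⟨?_, ?_⟩
  · intro x y hxy
    simpa [Subtype.ext_iff] using hxy
  · rintro ⟨x | x, hx⟩
    · exact ⟨⟨x, (h _).1 hx⟩, rfl⟩
    · exact absurd hx (h' x)

lemma card_sum_right (P : V1 ⊕ V2 → Prop) (Q : V2 → Prop) (h : ∀ v, P (Sum.inr v) ↔ Q v)
    (h' : ∀ v, ¬ P (Sum.inl v)) : Nat.card {x // P x} = Nat.card {x // Q x} := by
  symm
  refine Nat.card_eq_of_bijective (fun x => ⟨Sum.inr x.1, (h _).2 x.2⟩) ⟨?_, ?_⟩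
  · intro x y hxy
    simpa [Subtype.ext_iff] using hxy
  · rintro ⟨x | x, hx⟩
    · exact absurd hx (h' x)
    · exact ⟨⟨x, (h _).1 hx⟩, rfl⟩

lemma card_subtype_all (P : V → Prop) (h : ∀ v, P v) : Nat.card {x // P x} = Nat.card V :=
  Nat.card_congr (Equiv.subtypeUnivEquiv h)

variable (p1 : D1 → V1) (p2 : D2 → V2)

lemma cond_glue_iff (h1 : par1 c = c) (h2 : par2 r = r) :
    Cond (fun u => u.isLeft = true) (fun i => i.isLeft = true) (Sum.inr r) (glue c par1 r par2)
      (Sum.map p1 p2) (Sum.inl c) ↔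
    Good c par1 p1 ∧ Good r par2 p2 ∧ Nat.card V1 < Nat.card D1 := by
  have cl : ∀ v, Nat.card {u // Below (glue c par1 r par2) u (Sum.inl v)} =
      Nat.card {u // Below par1 u v} := fun v =>
    card_sum_left _ _ (fun u => below_ll h1 u v) (fun u => below_rl u v)
  have dl : ∀ v, Nat.card {i // Below (glue c par1 r par2) (Sum.map p1 p2 i) (Sum.inl v)} =
      Nat.card {i // Below par1 (p1 i) v} := fun v =>
    card_sum_left _ _ (fun u => below_ll h1 _ v) (fun u => below_rl _ v)
  have cr : ∀ v, v ≠ r → Nat.card {u // Below (glue c par1 r par2) u (Sum.inr v)} =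
      Nat.card {u // Below par2 u v} := fun v hv =>
    card_sum_right _ _ (fun u => below_rr u v) (fun u hu => hv (below_lr h2 u v hu).symm)
  have dr : ∀ v, v ≠ r → Nat.card {i // Below (glue c par1 r par2) (Sum.map p1 p2 i) (Sum.inr v)} =
      Nat.card {i // Below par2 (p2 i) v} := fun v hv =>
    card_sum_right _ _ (fun u => below_rr _ v) (fun u hu => hv (below_lr h2 _ v hu).symm)
  constructor
  · rintro ⟨⟨-, ht, hg⟩, -, -, hS, hE⟩
    have ht1 : ∀ v, Below par1 v c := fun v => (below_ll h1 v c).1 ((hS (Sum.inl v)).2 rfl)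
    refine ⟨⟨h1, ht1, ?_⟩, ⟨h2, ?_, ?_⟩, ?_⟩
    · intro v _
      rw [← cl, ← dl]
      exact hg _ (by simp)
    · intro v
      exact (below_rr v r).1 (ht _)
    · intro v hv
      rw [← cr v hv, ← dr v hv]
      exact hg _ (by simpa using hv)
    · have := hg (Sum.inl c) (by simp)
      rwa [cl, dl, card_subtype_all _ ht1, card_subtype_all _ fun i => ht1 _] at this
  · rintro ⟨⟨-, ht1, hg1⟩, ⟨-, ht2, hg2⟩, hc⟩
    refine ⟨⟨by rw [glue_inr, h2], ?_, ?_⟩, by simp, glue_c, ?_, ?_⟩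
    · rintro (v | v)
      · refine ((below_ll h1 v c).2 (ht1 v)).trans (Below.step ?_)
        rw [glue_c]
        exact Below.refl _ _
      · exact (below_rr v r).2 (ht2 v)
    · rintro (v | v) hv
      · rw [cl, dl]
        by_cases h : v = c
        · subst h
          rwa [card_subtype_all _ ht1, card_subtype_all _ fun i => ht1 _]
        · exact hg1 v h
      · have hv : v ≠ r := by simpa using hv
        rw [cr v hv, dr v hv]
        exact hg2 v hv
    · rintro (v | v)
      · simp [below_ll h1, ht1]
      · simp [below_rl]
    · rintro (v | v)
      · simp [below_ll h1, ht1]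
      · simp [below_rl]

end Glue

lemma CObj_sum [Finite V1] [Finite V2] [Finite D1] [Finite D2]
    (hc : Nat.card V1 < Nat.card D1) :
    Nat.card (CObj (V := V1 ⊕ V2) (D := D1 ⊕ D2) (fun u => u.isLeft = true)
      (fun i => i.isLeft = true)) = NN V1 D1 * NN V2 D2 := by
  rw [NN, NN, ← Nat.card_prod]
  symm
  refine Nat.card_eq_of_bijective (fun x => ⟨(Sum.inr x.2.1.1, glue x.1.1.1 x.1.1.2.1 x.2.1.1
    x.2.1.2.1, Sum.map x.1.1.2.2 x.2.1.2.2, Sum.inl x.1.1.1), (cond_glue_iff _ _ x.1.2.1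
      x.2.2.1).2 ⟨x.1.2, x.2.2, hc⟩⟩) ⟨?_, ?_⟩
  · rintro ⟨⟨⟨c, par1, p1⟩, g1⟩, ⟨⟨r, par2, p2⟩, g2⟩⟩ ⟨⟨⟨c', par1', p1'⟩, g1'⟩, ⟨⟨r', par2', p2'⟩, g2'⟩⟩ h
    simp only [Subtype.mk.injEq, Prod.mk.injEq, Sum.inr.injEq, Sum.inl.injEq] at h
    obtain ⟨rfl, hpar, hp, rfl⟩ := h
    have e1 : par1 = par1' := by
      funext v
      by_cases hv : v = c
      · subst hv
        exact g1.1.trans g1'.1.symm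
      · have := congrFun hpar (Sum.inl v)
        rw [glue_inl hv, glue_inl hv] at this
        exact Sum.inl_injective this
    have e2 : par2 = par2' := by
      funext v
      have := congrFun hpar (Sum.inr v)
      rw [glue_inr, glue_inr] at this
      exact Sum.inr_injective this
    have e3 : p1 = p1' := by
      funext v
      exact Sum.inl_injective (congrFun hp (Sum.inl v))
    have e4 : p2 = p2' := by
      funext v
      exact Sum.inr_injective (congrFun hp (Sum.inr v))
    subst e1 e2 e3 e4
    rfl
  · rintro ⟨⟨r, par, p, c⟩, hx⟩
    have hx' := hx
    obtain ⟨⟨hr, ht, hg⟩, hcr, hpc, hS, hE⟩ := hx'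
    dsimp only at hr ht hg hcr hpc hS hE hx
    obtain ⟨c, rfl⟩ : ∃ c', c = Sum.inl c' := by
      have := (hS c).1 (Below.refl _ _)
      exact Sum.isLeft_iff.1 this
    have hrr : ∃ r', r = Sum.inr r' := by
      rcases r with r | r
      · exact absurd (Below.of_fixed hr ((hS (Sum.inl r)).2 rfl)).symm hcr
      · exact ⟨r, rfl⟩
    obtain ⟨r, rfl⟩ := hrr
    have hl : ∀ v : V1, ∃ w : V1, (v = c → w = c) ∧ (v ≠ c → par (Sum.inl v) = Sum.inl w) := by
      intro v
      by_cases hv : v = c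
      · exact ⟨c, fun _ => rfl, fun h => absurd hv h⟩
      · rcases ((hS (Sum.inl v)).2 rfl).eq_or with h | h
        · exact absurd (Sum.inl_injective h) hv
        · obtain ⟨w, hw⟩ := Sum.isLeft_iff.1 ((hS _).1 h)
          exact ⟨w, fun h => absurd h hv, fun _ => hw⟩
    have hrt : ∀ v : V2, ∃ w : V2, par (Sum.inr v) = Sum.inr w := by
      intro v
      rcases h : par (Sum.inr v) with w | w
      · have : Below par (Sum.inr v) (Sum.inl c) := by
          apply Below.step
          rw [h]
          exact (hS _).2 rfl
        simpa using (hS _).1 this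
      · exact ⟨w, rfl⟩
    have hpl : ∀ i : D1, ∃ w : V1, p (Sum.inl i) = Sum.inl w := fun i =>
      Sum.isLeft_iff.1 ((hS _).1 ((hE (Sum.inl i)).2 rfl))
    have hpr : ∀ i : D2, ∃ w : V2, p (Sum.inr i) = Sum.inr w := by
      intro i
      rcases h : p (Sum.inr i) with w | w
      · have := (hE (Sum.inr i)).1 (by rw [h]; exact (hS _).2 rfl)
        simp at this
      · exact ⟨w, rfl⟩
    choose par1 hp1c hp1 using hl
    choose par2 hp2 using hrt
    choose p1 hq1 using hpl
    choose p2 hq2 using hpr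
    have epar : par = glue c par1 r par2 := by
      funext v
      rcases v with v | v
      · by_cases hv : v = c
        · subst hv
          rw [hpc, glue_c]
        · rw [glue_inl hv, hp1 v hv]
      · rw [glue_inr, hp2]
    have ep : p = Sum.map p1 p2 := by
      funext i
      rcases i with i | i
      · exact hq1 i
      · exact hq2 i
    subst epar ep
    have f2 : par2 r = r := by
      rw [glue_inr] at hr
      exact Sum.inr_injective hr
    obtain ⟨g1, g2, -⟩ := (cond_glue_iff p1 p2 (hp1c c rfl) f2).1 hx
    exact ⟨⟨⟨⟨c, par1, p1⟩, g1⟩, ⟨⟨r, par2, p2⟩, g2⟩⟩, rfl⟩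

/-- `NN` on `Fin`. -/
noncomputable def nn (n m : ℕ) : ℕ := NN (Fin n) (Fin m)

lemma NN_eq [Finite V] [Finite D] {n m : ℕ} (hn : Nat.card V = n) (hm : Nat.card D = m) :
    NN V D = nn n m := NN_congr (Finite.equivFinOfCardEq hn) (Finite.equivFinOfCardEq hm)

lemma CObj_card [Fintype V] [Fintype D] (S : Finset V) (E : Finset D) :
    Nat.card (CObj (fun u => u ∈ S) (fun i => i ∈ E)) =
      if #S < #E then nn #S #E * nn (Fintype.card V - #S) (Fintype.card D - #E) else 0 := by
  classical
  split_ifs with h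
  · rw [← CObj_congr (Equiv.sumCompl (fun u => u ∈ S)) (Equiv.sumCompl (fun i => i ∈ E))
      (fun u => u.isLeft = true) _ (fun u => u.isLeft = true)]
    · rw [CObj_sum (by simpa using h)]
      congr 1
      · exact NN_eq (by simp) (by simp)
      · refine NN_eq ?_ ?_
        · rw [Nat.card_eq_fintype_card, Fintype.card_subtype_compl]; simp
        · rw [Nat.card_eq_fintype_card, Fintype.card_subtype_compl]; simp
    · rintro (⟨u, hu⟩ | ⟨u, hu⟩) <;> simp [hu]
    · rintro (⟨u, hu⟩ | ⟨u, hu⟩) <;> simp [hu]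
  · rw [Nat.card_eq_zero]
    left
    refine ⟨fun x => h ?_⟩
    obtain ⟨⟨r, par, p, c⟩, ⟨hr, ht, hg⟩, hcr, hpc, hS, hE⟩ := x
    have := hg c hcr
    simp only [hE] at this
    simp only [hS] at this
    simpa using this


abbrev Tr (V D : Type) := {x : V × (V → V) × (D → V) × V //
  Good x.1 x.2.1 x.2.2.1 ∧ x.2.2.2 ≠ x.1 ∧ x.2.1 x.2.2.2 = x.1}

lemma exists_child {par : V → V} {r : V} {u : V} (h : Below par u r) (hu : u ≠ r) :
    ∃ c, c ≠ r ∧ par c = r ∧ Below par u c := by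
  obtain ⟨k, hk⟩ := h
  induction k generalizing u with
  | zero => exact absurd hk hu
  | succ k ih =>
    rw [Function.iterate_succ_apply] at hk
    by_cases h : par u = r
    · exact ⟨u, hu, h, Below.refl _ _⟩
    · obtain ⟨c, h1, h2, h3⟩ := ih h hk
      exact ⟨c, h1, h2, h3.step⟩

lemma unique_child {par : V → V} {r : V} (hr : par r = r) {u c c' : V} (h1 : c ≠ r)
    (h2 : par c = r) (h3 : Below par u c) (h1' : c' ≠ r)
    (h2' : par c' = r) (h3' : Below par u c') : c = c' := by
  obtain ⟨k, hk⟩ := h3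
  obtain ⟨l, hl⟩ := h3'
  induction k generalizing u l with
  | zero =>
    obtain rfl : u = c := hk
    rcases Below.eq_or ⟨l, hl⟩ with h | h
    · exact h
    · rw [h2] at h
      exact absurd (Below.of_fixed hr h).symm h1'
  | succ k ih =>
    cases l with
    | zero =>
      obtain rfl : u = c' := hl
      rcases Below.eq_or ⟨_, hk⟩ with h | h
      · exact h.symm
      · rw [h2'] at h
        exact absurd (Below.of_fixed hr h).symm h1
    | succ l =>
      rw [Function.iterate_succ_apply] at hk hl
      exact ih hk l hl

lemma child_card {I : Type} (f : V × (V → V) × (D → V) → I → V) :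
    Nat.card (Σ t : Tr V D, {i // Below t.1.2.1 (f (t.1.1, t.1.2.1, t.1.2.2.1) i) t.1.2.2.2}) =
      Nat.card (Σ x : Obj V D, {i // f x.1 i ≠ x.1.1}) := by
  refine Nat.card_eq_of_bijective (fun t => ⟨⟨(t.1.1.1, t.1.1.2.1, t.1.1.2.2.1), t.1.2.1⟩,
    ⟨t.2.1, ?_⟩⟩) ⟨?_, ?_⟩
  · intro h
    have h2 := t.2.2
    rw [h] at h2
    exact t.1.2.2.1 (Below.of_fixed t.1.2.1.1 h2).symm
  · rintro ⟨⟨⟨r, par, p, c⟩, hg, h1, h2⟩, ⟨i, hi⟩⟩ ⟨⟨⟨r', par', p', c'⟩, hg', h1', h2'⟩, ⟨i', hi'⟩⟩ h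
    have h0 := congrArg (fun z => (z.1.1, z.2.1)) h
    simp only [Prod.mk.injEq] at h0
    obtain ⟨⟨rfl, rfl, rfl⟩, rfl⟩ := h0
    obtain rfl : c = c' := unique_child hg.1 h1 h2 hi h1' h2' hi'
    rfl
  · rintro ⟨⟨⟨r, par, p⟩, hg⟩, ⟨i, hi⟩⟩
    obtain ⟨c, h1, h2, h3⟩ := exists_child (hg.2.1 (f (r, par, p) i)) hi
    exact ⟨⟨⟨⟨r, par, p, c⟩, hg, h1, h2⟩, ⟨i, h3⟩⟩, rfl⟩

open Classical in
lemma tr_sum [Fintype V] [Fintype D] (g : ℕ → ℕ → ℕ) :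
    ∑ t : Tr V D, g (Nat.card {u // Below t.1.2.1 u t.1.2.2.2})
      (Nat.card {i // Below t.1.2.1 (t.1.2.2.1 i) t.1.2.2.2}) =
    ∑ j ∈ range (Fintype.card D + 1), ∑ i ∈ range (Fintype.card V + 1),
      (Fintype.card V).choose i * ((Fintype.card D).choose j *
      ((if i < j then nn i j * nn (Fintype.card V - i) (Fintype.card D - j) else 0) * g i j)) := by
  let φ : Tr V D → Finset D × Finset V := fun t =>
    (univ.filter fun i => Below t.1.2.1 (t.1.2.2.1 i) t.1.2.2.2,
      univ.filter fun u => Below t.1.2.1 u t.1.2.2.2)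
  have h1 : ∀ t : Tr V D, g (Nat.card {u // Below t.1.2.1 u t.1.2.2.2})
      (Nat.card {i // Below t.1.2.1 (t.1.2.2.1 i) t.1.2.2.2}) = g #(φ t).2 #(φ t).1 := by
    intro t
    simp only [φ]
    rw [Nat.card_eq_fintype_card, Nat.card_eq_fintype_card, Fintype.card_subtype,
      Fintype.card_subtype]
  rw [Finset.sum_congr rfl fun t _ => h1 t, ← Finset.sum_fiberwise univ φ]
  rw [Fintype.sum_prod_type]
  have h2 : ∀ (E : Finset D) (S : Finset V),
      ∑ t : Tr V D with φ t = (E, S), g #(φ t).2 #(φ t).1 =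
      (if #S < #E then nn #S #E * nn (Fintype.card V - #S) (Fintype.card D - #E) else 0) *
        g #S #E := by
    intro E S
    rw [← CObj_card S E, Finset.sum_congr rfl (g := fun _ => g #S #E)]
    · rw [Finset.sum_const, smul_eq_mul]
      congr 1
      rw [← Fintype.card_subtype, ← Nat.card_eq_fintype_card]
      refine Nat.card_eq_of_bijective (fun t => ⟨t.1.1, t.1.2.1, t.1.2.2.1, t.1.2.2.2, ?_, ?_⟩)
        ⟨?_, ?_⟩
      · intro u
        have := Finset.ext_iff.1 (congrArg Prod.snd t.2) u
        simpa [φ] using this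
      · intro u
        have := Finset.ext_iff.1 (congrArg Prod.fst t.2) u
        simpa [φ] using this
      · intro x y hxy
        have hxy := congrArg Subtype.val hxy
        exact Subtype.ext (Subtype.ext hxy)
      · rintro ⟨x, h1, h2, h3, h4, h5⟩
        refine ⟨⟨⟨x, h1, h2, h3⟩, ?_⟩, rfl⟩
        simp only [φ, h5]
        simp [h4]
    · intro t ht
      have := (Finset.mem_filter.1 ht).2
      rw [this]
  simp only [h2]
  have h3 : ∀ E : Finset D, ∑ S : Finset V, (if #S < #E then nn #S #E *
      nn (Fintype.card V - #S) (Fintype.card D - #E) else 0) * g #S #E =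
      ∑ i ∈ range (Fintype.card V + 1), (Fintype.card V).choose i *
        ((if i < #E then nn i #E * nn (Fintype.card V - i) (Fintype.card D - #E) else 0) *
          g i #E) := by
    intro E
    have := Finset.sum_powerset_apply_card (fun i => (if i < #E then nn i #E *
      nn (Fintype.card V - i) (Fintype.card D - #E) else 0) * g i #E) (x := (univ : Finset V))
    simpa using this
  simp only [h3]
  have := Finset.sum_powerset_apply_card (fun j => ∑ i ∈ range (Fintype.card V + 1),
    (Fintype.card V).choose i *
        ((if i < j then nn i j * nn (Fintype.card V - i) (Fintype.card D - j) else 0) *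
          g i j)) (x := (univ : Finset D))
  simp only [powerset_univ, card_univ, smul_eq_mul] at this
  rw [this]
  refine Finset.sum_congr rfl fun j _ => ?_
  rw [Finset.mul_sum]
  refine Finset.sum_congr rfl fun i _ => ?_
  ring


open Classical in
lemma card_sigma_V [Fintype V] [Fintype D] :
    Nat.card (Σ t : Tr V D, {u // Below t.1.2.1 u t.1.2.2.2}) =
    ∑ j ∈ range (Fintype.card D + 1), ∑ i ∈ range (Fintype.card V + 1),
      (Fintype.card V).choose i * ((Fintype.card D).choose j *
      ((if i < j then nn i j * nn (Fintype.card V - i) (Fintype.card D - j) else 0) * i)) :=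
  Nat.card_sigma.trans (tr_sum (fun i _ => i))

open Classical in
lemma card_sigma_D [Fintype V] [Fintype D] :
    Nat.card (Σ t : Tr V D, {i // Below t.1.2.1 (t.1.2.2.1 i) t.1.2.2.2}) =
    ∑ j ∈ range (Fintype.card D + 1), ∑ i ∈ range (Fintype.card V + 1),
      (Fintype.card V).choose i * ((Fintype.card D).choose j *
      ((if i < j then nn i j * nn (Fintype.card V - i) (Fintype.card D - j) else 0) * j)) :=
  Nat.card_sigma.trans (tr_sum (fun _ j => j))

open Classical in
lemma card_obj_V [Fintype V] [Fintype D] :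
    Nat.card (Σ x : Obj V D, {i : V // i ≠ x.1.1}) = NN V D * (Fintype.card V - 1) := by
  rw [Nat.card_sigma]
  have h3 : ∀ x : Obj V D, Nat.card {i // i ≠ x.1.1} = Fintype.card V - 1 := by
    intro x
    simp
  simp only [h3, sum_const, card_univ, smul_eq_mul]
  rw [← Nat.card_eq_fintype_card]
  rfl

open Classical in
lemma card_obj_D [Fintype V] [Fintype D] :
    Fintype.card D * NN V D = ∑ i : D, Nat.card {x : Obj V D // x.1.2.2 i = x.1.1} +
      Nat.card (Σ x : Obj V D, {i : D // x.1.2.2 i ≠ x.1.1}) := by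
  rw [Nat.card_sigma]
  have h3 : ∑ i : D, Nat.card {x : Obj V D // x.1.2.2 i = x.1.1} =
      ∑ x : Obj V D, Nat.card {i // x.1.2.2 i = x.1.1} := by
    simp only [Nat.card_eq_fintype_card, Fintype.card_subtype, card_filter]
    exact Finset.sum_comm
  rw [h3, ← Finset.sum_add_distrib]
  have h4 : ∀ x : Obj V D, Nat.card {i // x.1.2.2 i = x.1.1} +
      Nat.card {i // x.1.2.2 i ≠ x.1.1} = Fintype.card D := by
    intro x
    simp only [Nat.card_eq_fintype_card]
    have := Fintype.card_subtype_compl (fun i => x.1.2.2 i = x.1.1)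
    have h5 := Fintype.card_subtype_le (fun i => x.1.2.2 i = x.1.1)
    simp only [ne_eq]
    omega
  simp only [h4, sum_const, card_univ, smul_eq_mul]
  rw [← Nat.card_eq_fintype_card (α := Obj V D), mul_comm]
  rfl

lemma nn_zero (m : ℕ) : nn 0 m = 0 := by
  unfold nn NN
  rw [Nat.card_eq_zero]
  left
  exact ⟨fun x => x.1.1.elim0⟩

lemma rec1 (n m : ℕ) : n * nn n m = nn n m +
    ∑ j ∈ range (m + 1), ∑ i ∈ range (n + 1), n.choose i * (m.choose j *
      ((if i < j then nn i j * nn (n - i) (m - j) else 0) * i)) := by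
  have h1 := card_sigma_V (V := Fin n) (D := Fin m)
  simp only [Fintype.card_fin] at h1
  rw [← h1]
  have h2 := child_card (V := Fin n) (D := Fin m) (I := Fin n) (fun _ i => i)
  rw [h2, card_obj_V]
  change _ = nn n m + nn n m * (Fintype.card (Fin n) - 1)
  rw [Fintype.card_fin]
  cases n with
  | zero => simp [nn_zero]
  | succ n => simp; ring

lemma root_driver (m n : ℕ) (i : Fin (m + 1)) :
    Nat.card {x : Obj (Fin n) (Fin (m + 1)) // x.1.2.2 i = x.1.1} = nn n m := by
  rw [← NN_eq (V := Fin n) (D := {j : Fin (m + 1) // j ≠ i}) (by simp) (by simp)]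
  have key : ∀ (r : Fin n) (par : Fin n → Fin n) (p : Fin (m + 1) → Fin n), p i = r →
      (Good r par p ↔ Good r par (fun j : {j : Fin (m + 1) // j ≠ i} => p j.1)) := by
    intro r par p hpi
    refine and_congr_right fun hr => and_congr_right fun ht => forall_congr' fun v =>
      imp_congr_right fun hv => ?_
    have : Nat.card {j // Below par (p j) v} =
        Nat.card {j : {j : Fin (m + 1) // j ≠ i} // Below par (p j.1) v} := by
      symm
      refine Nat.card_eq_of_bijective (fun j => ⟨j.1.1, j.2⟩) ⟨?_, ?_⟩
      · intro x y hxy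
        simp only [Subtype.mk.injEq] at hxy
        exact Subtype.ext (Subtype.ext hxy)
      · rintro ⟨j, hj⟩
        refine ⟨⟨⟨j, ?_⟩, hj⟩, rfl⟩
        rintro rfl
        rw [hpi] at hj
        exact hv (Below.of_fixed hr hj).symm
    rw [this]
  refine Nat.card_eq_of_bijective (fun x => ⟨(x.1.1.1, x.1.1.2.1, fun j => x.1.1.2.2 j.1),
    (key _ _ _ x.2).1 x.1.2⟩) ⟨?_, ?_⟩
  · rintro ⟨⟨⟨r, par, p⟩, hg⟩, h⟩ ⟨⟨⟨r', par', p'⟩, hg'⟩, h'⟩ hh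
    simp only [Subtype.mk.injEq, Prod.mk.injEq] at hh h h'
    obtain ⟨rfl, rfl, hp⟩ := hh
    have : p = p' := by
      funext j
      by_cases hj : j = i
      · subst hj
        rw [h, h']
      · exact congrFun hp ⟨j, hj⟩
    subst this
    rfl
  · rintro ⟨⟨r, par, p⟩, hg⟩
    have e : (fun j : {j : Fin (m + 1) // j ≠ i} =>
        (fun j => if h : j = i then r else p ⟨j, h⟩) j.1) = p := by
      funext j
      simp [j.2]
    refine ⟨⟨⟨⟨r, par, fun j => if h : j = i then r else p ⟨j, h⟩⟩, ?_⟩, ?_⟩, ?_⟩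
    · refine (key _ _ _ (by simp)).2 ?_
      dsimp only at e ⊢
      rw [e]
      exact hg
    · simp
    · refine Subtype.ext ?_
      dsimp only at e ⊢
      rw [e]

lemma rec2 (n m : ℕ) : m * nn n m = (if m = 0 then 0 else m * nn n (m - 1)) +
    ∑ j ∈ range (m + 1), ∑ i ∈ range (n + 1), n.choose i * (m.choose j *
      ((if i < j then nn i j * nn (n - i) (m - j) else 0) * j)) := by
  have h1 := card_sigma_D (V := Fin n) (D := Fin m)
  simp only [Fintype.card_fin] at h1
  rw [← h1]
  have h2 := child_card (V := Fin n) (D := Fin m) (I := Fin m) (fun x i => x.2.2 i)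
  rw [h2]
  have h3 := card_obj_D (V := Fin n) (D := Fin m)
  rw [Fintype.card_fin] at h3
  refine h3.trans ?_
  congr 1
  cases m with
  | zero => simp
  | succ m => simp [root_driver]

lemma nn_one_zero : nn 1 0 = 1 := by
  unfold nn NN
  rw [Nat.card_eq_one_iff_unique]
  refine ⟨⟨fun x y => Subtype.ext (Subsingleton.elim _ _)⟩,
    ⟨⟨(0, id, Fin.elim0), rfl, fun v => ⟨0, Subsingleton.elim _ _⟩, fun v hv => ?_⟩⟩⟩
  exact absurd (Subsingleton.elim _ _) hv

lemma nn_support (n m : ℕ) (h : nn n m ≠ 0) : n ≤ m ∨ (n = 1 ∧ m = 0) := by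
  induction n using Nat.strong_induction_on generalizing m with
  | _ n ih =>
    by_contra hcon
    have h1 := rec1 n m
    have hz : ∑ j ∈ range (m + 1), ∑ i ∈ range (n + 1), n.choose i * (m.choose j *
      ((if i < j then nn i j * nn (n - i) (m - j) else 0) * i)) = 0 := by
      refine Finset.sum_eq_zero fun j hj => Finset.sum_eq_zero fun i hi => ?_
      split_ifs with hij
      · by_cases hi0 : i = 0
        · simp [hi0]
        · have hj' := Finset.mem_range.1 hj
          have hi' := Finset.mem_range.1 hi
          have : nn (n - i) (m - j) = 0 := by
            by_contra hne
            have := ih (n - i) (by omega) (m - j) hne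
            omega
          simp [this]
      · simp
    rw [hz, add_zero] at h1
    have hn1 : n = 1 := by
      have : n * nn n m = 1 * nn n m := by rw [h1, one_mul]
      exact Nat.eq_of_mul_eq_mul_right (Nat.pos_of_ne_zero h) this
    omega

end Comb
end PrimePark

namespace PrimePark
open Finset

lemma nn_diag (n : ℕ) : nn (n + 1) (n + 1) = (2 * n).factorial := by
  have conv : ∀ (n m : ℕ) (w : ℕ → ℕ → ℕ),
      ((∑ j ∈ range (m + 1), ∑ i ∈ range (n + 1), n.choose i * (m.choose j *
        ((if i < j then nn i j * nn (n - i) (m - j) else 0) * w i j)) : ℕ) : ℚ) /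
        (n.factorial * m.factorial) =
      ∑ j ∈ HasAntidiagonal.antidiagonal m, ∑ i ∈ HasAntidiagonal.antidiagonal n,
        ((nn i.1 j.1 : ℚ) / (i.1.factorial * j.1.factorial)) *
        (if i.2 < j.2 then (w i.2 j.2 : ℚ) * ((nn i.2 j.2 : ℚ) /
          (i.2.factorial * j.2.factorial)) else 0) := by
    intro n m w
    have e1 : ∀ (n : ℕ) (G : ℕ → ℕ → ℕ), ∑ i ∈ range (n + 1), G i (n - i) =
        ∑ i ∈ HasAntidiagonal.antidiagonal n, G i.2 i.1 := by
      intro n G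
      rw [← Finset.Nat.sum_antidiagonal_eq_sum_range_succ G, ← Finset.Nat.sum_antidiagonal_swap]
      rfl
    have e2 : ∀ j j', ∑ i ∈ range (n + 1), n.choose i * (m.choose j *
        ((if i < j then nn i j * nn (n - i) j' else 0) * w i j)) =
        ∑ i ∈ HasAntidiagonal.antidiagonal n, n.choose i.2 * (m.choose j *
        ((if i.2 < j then nn i.2 j * nn i.1 j' else 0) * w i.2 j)) := fun j j' =>
      e1 n fun i i' => n.choose i * (m.choose j *
        ((if i < j then nn i j * nn i' j' else 0) * w i j))
    simp only [e2]
    rw [e1 m fun j j' => ∑ i ∈ HasAntidiagonal.antidiagonal n, n.choose i.2 * (m.choose j *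
        ((if i.2 < j then nn i.2 j * nn i.1 j' else 0) * w i.2 j))]
    rw [Nat.cast_sum, Finset.sum_div]
    refine Finset.sum_congr rfl fun j hj => ?_
    rw [Nat.cast_sum, Finset.sum_div]
    refine Finset.sum_congr rfl fun i hi => ?_
    have hj := HasAntidiagonal.mem_antidiagonal.1 hj
    have hi := HasAntidiagonal.mem_antidiagonal.1 hi
    split_ifs with h
    · have f1 := Nat.choose_mul_factorial_mul_factorial (show i.2 ≤ n by omega)
      have f2 := Nat.choose_mul_factorial_mul_factorial (show j.2 ≤ m by omega)
      rw [show n - i.2 = i.1 by omega] at f1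
      rw [show m - j.2 = j.1 by omega] at f2
      rw [← f1, ← f2]
      have c1 : (n.choose i.2 : ℚ) ≠ 0 := by
        exact_mod_cast (Nat.choose_pos (show i.2 ≤ n by omega)).ne'
      have c2 : (m.choose j.2 : ℚ) ≠ 0 := by
        exact_mod_cast (Nat.choose_pos (show j.2 ≤ m by omega)).ne'
      have := Nat.factorial_ne_zero
      push_cast
      field_simp
    · simp
  have key := series_main (fun n m => (nn n m : ℚ) / (n.factorial * m.factorial))
    (by simp [nn_one_zero]) (by
      intro n m h
      apply nn_support
      rintro h0
      simp [h0] at h) (by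
      intro n m
      have h := congrArg (fun z : ℕ => (z : ℚ) / (n.factorial * m.factorial)) (rec1 n m)
      beta_reduce at h
      rw [Nat.cast_add, add_div, conv n m (fun i _ => i), Nat.cast_mul, mul_div_assoc] at h
      exact h) (by
      intro n m
      have h := congrArg (fun z : ℕ => (z : ℚ) / (n.factorial * m.factorial)) (rec2 n m)
      beta_reduce at h
      rw [Nat.cast_add, add_div, conv n m (fun _ j => j), Nat.cast_mul, mul_div_assoc] at h
      rw [h]
      congr 1
      cases m with
      | zero => simp
      | succ m =>
        simp only [Nat.succ_ne_zero, if_false, Nat.add_sub_cancel]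
        rw [Nat.factorial_succ]
        push_cast
        field_simp) n
  have hc := succ_mul_catalan_eq_centralBinom n
  have hb := Nat.choose_mul_factorial_mul_factorial (show n ≤ 2 * n by omega)
  rw [show 2 * n - n = n by omega] at hb
  rw [Nat.centralBinom] at hc
  rw [← hc] at hb
  have hbq : (((2 * n).factorial : ℕ) : ℚ) = (n + 1) * catalan n * n.factorial * n.factorial := by
    rw [← hb]; push_cast; ring
  have : (nn (n + 1) (n + 1) : ℚ) = ((2 * n).factorial : ℕ) := by
    rw [hbq, ← key, Nat.factorial_succ]
    have := Nat.factorial_ne_zero n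
    push_cast
    field_simp
  exact_mod_cast this

lemma below_iff {n : ℕ} (par : Fin n → Fin n) (u v : Fin n) :
    Below par u v ↔ ∃ k ∈ Finset.range n, par^[k] u = v := by
  classical
  constructor
  · intro h
    refine ⟨Nat.find h, ?_, Nat.find_spec h⟩
    by_contra hk
    rw [Finset.mem_range, not_lt] at hk
    obtain ⟨i, hi, j, hj, hij, he⟩ := Finset.exists_ne_map_eq_of_card_lt_of_maps_to
      (s := Finset.range (Nat.find h + 1)) (t := (Finset.univ : Finset (Fin n)))
      (f := fun k => par^[k] u) (by simp; omega) (by intro x _; simp)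
    rw [Finset.mem_range] at hi hj
    have key : ∀ i j : ℕ, i < j → j < Nat.find h + 1 → par^[i] u = par^[j] u → False := by
      intro i j hlt hj he
      refine Nat.find_min h (m := (Nat.find h - j) + i) (by omega) ?_
      rw [Function.iterate_add_apply, he, ← Function.iterate_add_apply,
        show Nat.find h - j + j = Nat.find h by omega]
      exact Nat.find_spec h
    rcases lt_or_gt_of_ne hij with h' | h'
    · exact key i j h' hj he
    · exact key j i h' hi he.symm
  · rintro ⟨k, -, hk⟩
    exact ⟨k, hk⟩

lemma mem_subtree {n : ℕ} (par : Fin n → Fin n) (u v : Fin n) :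
    u ∈ subtree par v ↔ Below par u v := by
  rw [below_iff]; simp [subtree]

lemma treeStep_eq {n : ℕ} (par : Fin n → Fin n) (occ : Finset (Fin n)) (w : Fin n) :
    occ ⊆ treeStep par occ w := by
  unfold treeStep
  split
  · exact Finset.subset_insert _ _
  · exact Finset.Subset.refl _

lemma treeStep_below {n : ℕ} (par : Fin n → Fin n) (occ : Finset (Fin n)) (v w : Fin n)
    (hv : v ∉ occ) (hw : Below par w v) :
    ∃ u, u ∉ occ ∧ Below par u v ∧ treeStep par occ w = insert u occ := by
  obtain ⟨k, hk, hkv⟩ := (below_iff _ _ _).1 hw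
  rw [Finset.mem_range] at hk
  unfold treeStep
  cases h : parkSpot par occ w with
  | none =>
    unfold parkSpot pathToRoot at h
    rw [List.find?_eq_none] at h
    have := h v (List.mem_map.2 ⟨k, List.mem_range.2 hk, hkv⟩)
    simp [hv] at this
  | some u =>
    refine ⟨u, ?_, ?_, rfl⟩
    · have := List.find?_some h
      simpa using this
    · unfold parkSpot pathToRoot at h
      rw [List.find?_map, Option.map_eq_some_iff] at h
      obtain ⟨j, hj, hju⟩ := h
      rw [List.find?_range_eq_some] at hj
      have hjk : j ≤ k := by
        by_contra hlt
        have := hj.2.2 k (by omega)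
        simp [hkv, hv] at this
      refine ⟨k - j, ?_⟩
      rw [← hju, ← Function.iterate_add_apply, show k - j + j = k by omega, hkv]

lemma fold_count {n : ℕ} (par : Fin n → Fin n) (v : Fin n) (l : List (Fin n))
    (hv : v ∉ l.foldl (treeStep par) ∅) :
    l.countP (fun w => decide (w ∈ subtree par v)) ≤
      #(l.foldl (treeStep par) ∅ ∩ subtree par v) := by
  induction l using List.reverseRecOn with
  | nil => simp
  | append_singleton l w ih =>
    rw [List.foldl_append, List.foldl_cons, List.foldl_nil] at hv ⊢
    set occ := l.foldl (treeStep par) ∅ with hocc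
    have hv' : v ∉ occ := fun h => hv (treeStep_eq par occ w h)
    have ih := ih hv'
    rw [List.countP_append]
    by_cases hw : w ∈ subtree par v
    · obtain ⟨u, hu, hb, he⟩ := treeStep_below par occ v w hv' ((mem_subtree _ _ _).1 hw)
      rw [he, Finset.insert_inter_of_mem ((mem_subtree _ _ _).2 hb),
        Finset.card_insert_of_notMem (fun h => hu (Finset.mem_inter.1 h).1)]
      simpa [hw] using ih
    · have : #(occ ∩ subtree par v) ≤ #(treeStep par occ w ∩ subtree par v) :=
        Finset.card_le_card (Finset.inter_subset_inter_right (treeStep_eq par occ w))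
      simp only [List.countP_singleton, hw, decide_false]
      simp
      omega

lemma countP_ofFn' {n : ℕ} (s : Fin n → Fin n) (A : Finset (Fin n)) :
    (List.ofFn s).countP (fun w => decide (w ∈ A)) = #{i | s i ∈ A} := by
  rw [List.ofFn_eq_map, List.countP_map, List.countP_eq_length_filter]
  rfl

lemma isTreePF_of {n : ℕ} (root : Fin n) (par s : Fin n → Fin n) (ht : IsRootedTree root par)
    (h : ∀ v, v ≠ root → #(subtree par v) < #{i | s i ∈ subtree par v}) :
    IsTreePF par s := by
  unfold IsTreePF occAfter
  rw [List.take_of_length_le (by simp)]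
  rw [Finset.eq_univ_iff_forall]
  intro v
  by_contra hv
  have h1 := fold_count par v _ hv
  rw [countP_ofFn'] at h1
  have h2 : #((List.ofFn s).foldl (treeStep par) ∅ ∩ subtree par v) < #(subtree par v) := by
    refine Finset.card_lt_card ⟨Finset.inter_subset_right, fun hh => hv ?_⟩
    exact (Finset.mem_inter.1 (hh ((mem_subtree _ _ _).2 (Below.refl _ _)))).1
  by_cases hr : v = root
  · subst hr
    have : ∀ u, u ∈ subtree par v := fun u => (mem_subtree _ _ _).2 ((below_iff _ _ _).2 (ht.2 u))
    have h3 : subtree par v = Finset.univ := Finset.eq_univ_iff_forall.2 this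
    rw [h3] at h1 h2
    simp at h1 h2
    omega
  · have := h v hr
    omega

lemma good_iff {n : ℕ} (root : Fin n) (par s : Fin n → Fin n) :
    (IsRootedTree root par ∧ IsPrimeTreePF root par s) ↔ Good root par s := by
  classical
  have e : (∀ v, v ≠ root → #(subtree par v) < #{i | s i ∈ subtree par v}) ↔
      ∀ v, v ≠ root → Nat.card {u // Below par u v} < Nat.card {i // Below par (s i) v} := by
    refine forall_congr' fun v => imp_congr_right fun _ => ?_
    simp only [← mem_subtree]
    rw [Nat.card_eq_fintype_card, Nat.card_eq_fintype_card, Fintype.card_subtype,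
      Fintype.card_subtype]
    simp
  have e2 : IsRootedTree root par ↔ (par root = root ∧ ∀ v, Below par v root) := by
    unfold IsRootedTree
    simp only [below_iff]
  unfold Good
  rw [← and_assoc, ← e, ← e2]
  constructor
  · rintro ⟨h1, h2, h3⟩
    exact ⟨h1, h3⟩
  · rintro ⟨h1, h3⟩
    exact ⟨h1, isTreePF_of root par s h1 h3, h3⟩

end PrimePark

/-- For `n ≥ 1`, the total number of pairs `(T, p)` of a rooted
tree `T` on `[n]` (encoded by its root and parent function) together with a prime
parking function `p` on `T` is `(2n - 2)!`. -/
theorem card_prime_tree_parking_functions (n : ℕ) (hn : 1 ≤ n) :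
    Fintype.card {x : Fin n × (Fin n → Fin n) × (Fin n → Fin n) //
        IsRootedTree x.1 x.2.1 ∧ IsPrimeTreePF x.1 x.2.1 x.2.2} =
      Nat.factorial (2 * n - 2) := by
  obtain ⟨k, rfl⟩ : ∃ k, n = k + 1 := ⟨n - 1, by omega⟩
  rw [← Nat.card_eq_fintype_card, show 2 * (k + 1) - 2 = 2 * k by omega, ← PrimePark.nn_diag k]
  exact Nat.card_congr (Equiv.subtypeEquivRight fun x => PrimePark.good_iff x.1 x.2.1 x.2.2)
end

section
/- The total number of pairs (T,s), where T is a rooted labeled tree on [n] and s is a parking function on T, equals ((n−1)!)^2 · Σ_{i=0}^{n−1} (n−i)·(2n)^i / i!. -/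
namespace TPF
open Finset PowerSeries

/-- coefficients of the tree function -/
def yc : ℕ → ℚ
  | 0 => 0
  | 1 => 1
  | (k + 2) => (k + 2 : ℚ) / (k + 1) * ∑ i : Fin (k + 1), yc (i + 1) * yc (k + 1 - i)
decreasing_by all_goals omega

noncomputable def Y : PowerSeries ℚ := PowerSeries.mk yc

lemma coeff_Y (k : ℕ) : coeff k Y = yc k := by simp [Y]

lemma constCoeff_Y : constantCoeff Y = 0 := by
  rw [← coeff_zero_eq_constantCoeff_apply, coeff_Y]; simp [yc]

lemma coeff_Y_sq (k : ℕ) : (k : ℚ) * coeff k (Y ^ 2) = (k - 1) * yc k := by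
  rcases k with _ | _ | k
  · simp [yc]
  · rw [sq, coeff_mul]
    simp [Finset.Nat.antidiagonal_succ, coeff_Y, yc]
  · rw [sq, coeff_mul, Finset.Nat.sum_antidiagonal_eq_sum_range_succ_mk, Finset.sum_range_succ,
      Finset.sum_range_succ']
    simp only [coeff_Y, yc, zero_mul, add_zero]
    rw [Nat.sub_self, yc, mul_zero, add_zero,
      Finset.sum_range (fun i => yc (i + 1) * yc (k + 1 + 1 - (i + 1)))]
    have : ∀ i : Fin (k + 1), k + 1 + 1 - ((i : ℕ) + 1) = k + 1 - i := fun i => by omega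
    simp only [this]
    push_cast
    have h : (k + 1 : ℚ) ≠ 0 := by positivity
    field_simp
    ring

lemma ode : X * d⁄dX ℚ Y = Y + X * d⁄dX ℚ (Y ^ 2) := by
  ext k
  rcases k with _ | k
  · simp [constCoeff_Y]
  · rw [map_add, coeff_succ_X_mul, coeff_succ_X_mul, coeff_derivative, coeff_derivative, coeff_Y]
    have := coeff_Y_sq (k + 1)
    push_cast at this
    linarith

lemma ode_pow (j : ℕ) :
    ((j + 2 : ℕ) : PowerSeries ℚ) * (X * d⁄dX ℚ (Y ^ (j + 1))) =
      ((j + 2 : ℕ) * (j + 1 : ℕ) : PowerSeries ℚ) * Y ^ (j + 1)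
        + (2 * (j + 1 : ℕ) : PowerSeries ℚ) * (X * d⁄dX ℚ (Y ^ (j + 2))) := by
  have h := ode
  simp only [Derivation.leibniz_pow, smul_eq_mul, nsmul_eq_mul] at h ⊢
  simp only [Nat.add_sub_cancel, show j + 2 - 1 = j + 1 by omega] at h ⊢
  push_cast at h ⊢
  linear_combination ((j : PowerSeries ℚ) + 2) * (j + 1) * Y ^ j * h

lemma coeff_rec (j k : ℕ) :
    ((j : ℚ) + 2) * (k - (j + 1)) * coeff k (Y ^ (j + 1)) =
      2 * (j + 1) * k * coeff k (Y ^ (j + 2)) := by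
  rcases k with _ | k
  · simp [constCoeff_Y]
  have h := congrArg (coeff (k + 1)) (ode_pow j)
  have c1 : ∀ (a : ℕ) (f : PowerSeries ℚ), coeff (k+1) ((a : PowerSeries ℚ) * f) = a * coeff (k+1) f := by
    intro a f
    rw [← nsmul_eq_mul, map_nsmul, nsmul_eq_mul]
  rw [map_add, show (2 : PowerSeries ℚ) = ((2 : ℕ) : PowerSeries ℚ) by norm_num, ← Nat.cast_mul,
    ← Nat.cast_mul, c1, c1, c1, coeff_succ_X_mul, coeff_succ_X_mul, coeff_derivative,
    coeff_derivative] at h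
  push_cast at h ⊢
  linarith

lemma coeff_lt (j k : ℕ) (h : k < j) : coeff k (Y ^ j) = 0 := by
  have : X ∣ Y := by rw [X_dvd_iff]; exact constCoeff_Y
  exact (X_pow_dvd_iff.1 (pow_dvd_pow_of_dvd this j)) k h

lemma coeff_diag (j : ℕ) : coeff j (Y ^ j) = 1 := by
  induction j with
  | zero => simp
  | succ j ih =>
    rw [pow_succ, coeff_mul, Finset.sum_eq_single (j, 1)]
    · simp [ih, coeff_Y, yc]
    · rintro ⟨a, b⟩ hab hne
      simp only [HasAntidiagonal.mem_antidiagonal] at hab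
      rcases lt_trichotomy a j with h | h | h
      · simp [coeff_lt j a h]
      · exact absurd (by simp; omega) hne
      · have : b = 0 := by omega
        subst this
        simp [constCoeff_Y]
    · simp

/-- the explicit coefficients of the powers of the tree function -/
lemma coeff_pow (i j : ℕ) :
    coeff (i + j + 1) (Y ^ (j + 1)) =
      (j + 1 : ℚ) / (i + j + 1) * (2 * (i + j + 1)) ^ i / (Nat.factorial i) := by
  induction i generalizing j with
  | zero =>
    have h : (j + 1 : ℚ) ≠ 0 := by positivity
    have := coeff_diag (j + 1)
    simp [h, this]
  | succ i ih =>
    have h1 := coeff_rec j (i + 1 + j + 1)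
    have h2 := ih (j + 1)
    rw [show i + (j + 1) + 1 = i + 1 + j + 1 by omega] at h2
    rw [show j + 2 = j + 1 + 1 by omega, h2] at h1
    have e1 : (j + 2 : ℚ) ≠ 0 := by positivity
    have e2 : (i + 1 : ℚ) ≠ 0 := by positivity
    have e3 : ((Nat.factorial i : ℕ) : ℚ) ≠ 0 := by positivity
    have e4 : (i + 1 + j + 1 : ℚ) ≠ 0 := by positivity
    have e5 : (i + (j + 1) + 1 : ℚ) ≠ 0 := by positivity
    push_cast at h1 ⊢
    rw [Nat.factorial_succ]
    push_cast
    rw [show (i + (j + 1) + 1 : ℚ) = i + 1 + j + 1 by ring] at h1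
    have h3 : (j + 2 : ℚ) * (i + 1) * coeff (i + 1 + j + 1) (Y ^ (j + 1)) =
        2 * (j + 1) * (i + 1 + j + 1) * ((j + 1 + 1) / (i + 1 + j + 1) *
          (2 * (i + 1 + j + 1)) ^ i / (Nat.factorial i)) := by
      rw [← h1]; ring
    have h4 : coeff (i + 1 + j + 1) (Y ^ (j + 1)) =
        2 * (j + 1) * (i + 1 + j + 1) * ((j + 1 + 1) / (i + 1 + j + 1) *
          (2 * (i + 1 + j + 1)) ^ i / (Nat.factorial i)) / ((j + 2 : ℚ) * (i + 1)) := by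
      rw [← h3]; field_simp
    rw [h4]
    field_simp
    ring

noncomputable def gc (k : ℕ) : ℚ := ∑ j ∈ range k, coeff k (Y ^ (j + 1))

lemma gc_ext (k N : ℕ) (h : k ≤ N) : gc k = ∑ j ∈ range N, coeff k (Y ^ (j + 1)) := by
  unfold gc
  apply Finset.sum_subset (by simpa using h)
  intro x _ hx
  exact coeff_lt _ _ (by simp at hx; omega)

lemma gc_rec (k : ℕ) : gc k = yc k + ∑ ab ∈ antidiagonal k, yc ab.1 * gc ab.2 := by
  have h : ∀ ab ∈ antidiagonal k,
      yc ab.1 * gc ab.2 = ∑ j ∈ range k, coeff ab.1 Y * coeff ab.2 (Y ^ (j + 1)) := by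
    intro ab hab
    rw [gc_ext ab.2 k (by simp at hab; omega), Finset.mul_sum, coeff_Y]
  rw [Finset.sum_congr rfl h, Finset.sum_comm]
  simp only [← coeff_mul, ← pow_succ']
  rw [gc_ext k (k + 1) (by omega), Finset.sum_range_succ']
  simp [coeff_Y, add_comm]

lemma gc_formula (n : ℕ) (hn : 1 ≤ n) :
    (Nat.factorial n : ℚ) * Nat.factorial (n - 1) * gc n = (Nat.factorial (n - 1) : ℚ) ^ 2 *
        ∑ i ∈ Finset.range n, ((n - i : ℕ) : ℚ) * (2 * n) ^ i / (Nat.factorial i) := by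
  obtain ⟨m, rfl⟩ : ∃ m, n = m + 1 := ⟨n - 1, by omega⟩
  unfold gc
  rw [← Finset.sum_range_reflect, Nat.factorial_succ, Nat.add_sub_cancel]
  have : ∀ i ∈ range (m + 1), coeff (m + 1) (Y ^ (m - i + 1)) =
      (((m + 1 - i : ℕ) : ℚ) * (2 * (m + 1 : ℕ)) ^ i / (Nat.factorial i)) / (m + 1) := by
    intro i hi
    simp at hi
    obtain ⟨j, rfl⟩ : ∃ j, m = i + j := ⟨m - i, by omega⟩
    have := coeff_pow i j
    rw [show i + j - i + 1 = j + 1 by omega, this, show i + j + 1 - i = j + 1 by omega]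
    push_cast
    ring
  rw [Finset.sum_congr rfl this, ← Finset.sum_div]
  have h : (m + 1 : ℚ) ≠ 0 := by positivity
  push_cast
  field_simp

/-- sum form of the recursion for the counts of trees with empty root -/
lemma yc_rec (n : ℕ) (hn : 2 ≤ n) :
    (Nat.factorial (n - 1) : ℚ) ^ 2 * yc n =
      Nat.factorial n * Nat.factorial (n - 2) * ∑ ab ∈ antidiagonal n, yc ab.1 * yc ab.2 := by
  have h := coeff_Y_sq n
  rw [sq, coeff_mul] at h
  simp only [coeff_Y] at h
  obtain ⟨m, rfl⟩ : ∃ m, n = m + 2 := ⟨n - 2, by omega⟩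
  rw [show m + 2 - 1 = m + 1 by omega, show m + 2 - 2 = m by omega, Nat.factorial_succ (m + 1),
    Nat.factorial_succ m]
  push_cast at h ⊢
  linear_combination (-(m + 1) * (Nat.factorial m : ℚ) ^ 2) * h
end TPF
namespace TPF
open Finset

variable {n : ℕ}

lemma parkSpot_eq_some {p : Fin n → Fin n} {O : Finset (Fin n)} {v u : Fin n} :
    parkSpot p O v = some u ↔
      ∃ k, k < n ∧ p^[k] v = u ∧ u ∉ O ∧ ∀ j < k, p^[j] v ∈ O := by
  unfold parkSpot pathToRoot
  rw [List.find?_map, Option.map_eq_some_iff]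
  constructor
  · rintro ⟨k, hk, rfl⟩
    rw [List.find?_range_eq_some] at hk
    simp at hk
    exact ⟨k, hk.2.1, rfl, hk.1, hk.2.2⟩
  · rintro ⟨k, hk, rfl, h1, h2⟩
    refine ⟨k, ?_, rfl⟩
    rw [List.find?_range_eq_some]
    simp
    exact ⟨h1, hk, h2⟩

/-- shortest path argument -/
lemma exists_short {p : Fin n → Fin n} {v u : Fin n} (h : ∃ k, p^[k] v = u) :
    ∃ k, k < n ∧ p^[k] v = u ∧ ∀ j < k, p^[j] v ≠ u := by
  classical
  refine ⟨Nat.find h, ?_, Nat.find_spec h, fun j hj => Nat.find_min h hj⟩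
  by_contra hcon
  push Not at hcon
  have hinj : Function.Injective (fun i : Fin (n + 1) => p^[(i : ℕ)] v) := by
    have key : ∀ i j : Fin (n + 1), i < j → p^[(i : ℕ)] v ≠ p^[(j : ℕ)] v := by
      intro i j hij he
      have hij' : (i : ℕ) < j := hij
      have hj := j.2
      have hs := Nat.find_spec h
      have h2 : p^[Nat.find h - j + i] v = u := by
        rw [Function.iterate_add_apply, he, ← Function.iterate_add_apply,
          Nat.sub_add_cancel (by omega)]
        exact hs
      exact Nat.find_min h (by omega) h2
    intro i j hij
    rcases lt_trichotomy i j with hl | hl | hl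
    · exact absurd hij (key _ _ hl)
    · exact hl
    · exact absurd hij.symm (key _ _ hl)
  have := Fintype.card_le_of_injective _ hinj
  simp at this

lemma spot_imp {p p' : Fin n → Fin n} {O O' : Finset (Fin n)} {v u : Fin n} (Q : Set (Fin n))
    (hv : v ∈ Q) (hO : ∀ w ∈ Q, (w ∈ O ↔ w ∈ O'))
    (hp : ∀ w ∈ Q, w ∈ O → p' w = p w ∧ p w ∈ Q)
    (h : parkSpot p O v = some u) : parkSpot p' O' v = some u ∧ u ∈ Q := by
  rw [parkSpot_eq_some] at h
  obtain ⟨k, hk, rfl, hu, hj⟩ := h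
  have key : ∀ j, j ≤ k → p'^[j] v = p^[j] v ∧ p^[j] v ∈ Q := by
    intro j
    induction j with
    | zero => intro _; exact ⟨rfl, hv⟩
    | succ j ih =>
      intro hjk
      obtain ⟨h1, h2⟩ := ih (by omega)
      rw [Function.iterate_succ_apply', Function.iterate_succ_apply', h1]
      exact hp _ h2 (hj j (by omega))
  refine ⟨?_, (key k le_rfl).2⟩
  rw [parkSpot_eq_some]
  refine ⟨k, hk, (key k le_rfl).1, ?_, ?_⟩
  · rwa [← hO _ (key k le_rfl).2]
  · intro j hjk
    rw [(key j hjk.le).1, ← hO _ (key j hjk.le).2]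
    exact hj j hjk

lemma spot_congr {p p' : Fin n → Fin n} {O O' : Finset (Fin n)} {v : Fin n} (Q : Set (Fin n))
    (hv : v ∈ Q) (hO : ∀ w ∈ Q, (w ∈ O ↔ w ∈ O'))
    (hp : ∀ w ∈ Q, w ∈ O → p' w = p w ∧ p w ∈ Q) :
    parkSpot p O v = parkSpot p' O' v := by
  ext u
  constructor
  · intro h; exact (spot_imp Q hv hO hp h).1
  · intro h
    refine (spot_imp Q hv (fun w hw => (hO w hw).symm) ?_ h).1
    intro w hw hw'
    have := hp w hw ((hO w hw).2 hw')
    exact ⟨this.1.symm, this.1 ▸ this.2⟩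

lemma treeStep_some {p : Fin n → Fin n} {O : Finset (Fin n)} {v u : Fin n}
    (h : parkSpot p O v = some u) : treeStep p O v = insert u O := by
  simp [treeStep, h]

lemma treeStep_none {p : Fin n → Fin n} {O : Finset (Fin n)} {v : Fin n}
    (h : parkSpot p O v = none) : treeStep p O v = O := by
  simp [treeStep, h]

lemma subset_treeStep (p : Fin n → Fin n) (O : Finset (Fin n)) (v : Fin n) :
    O ⊆ treeStep p O v := by
  cases h : parkSpot p O v with
  | none => rw [treeStep_none h]
  | some u => rw [treeStep_some h]; exact subset_insert _ _

lemma treeStep_union {p : Fin n → Fin n} {O₁ O₂ : Finset (Fin n)} {v : Fin n} (Q : Set (Fin n))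
    (hv : v ∈ Q) (h1 : ∀ w ∈ O₁, w ∈ Q) (h2 : ∀ w ∈ O₂, w ∉ Q) (hp : ∀ w ∈ O₁, p w ∈ Q) :
    treeStep p (O₁ ∪ O₂) v = treeStep p O₁ v ∪ O₂ ∧ ∀ w ∈ treeStep p O₁ v, w ∈ Q := by
  have hc : parkSpot p O₁ v = parkSpot p (O₁ ∪ O₂) v := by
    refine spot_congr Q hv ?_ (fun w _ hw' => ⟨rfl, hp w hw'⟩)
    intro w hw
    have := h2 w
    simp only [mem_union]
    tauto
  cases h : parkSpot p O₁ v with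
  | none =>
    rw [treeStep_none h, treeStep_none (hc ▸ h)]
    exact ⟨rfl, h1⟩
  | some u =>
    rw [treeStep_some h, treeStep_some (hc ▸ h)]
    refine ⟨(insert_union _ _ _).symm, ?_⟩
    have hu := (spot_imp (p' := p) (O' := O₁) Q hv (fun _ _ => Iff.rfl)
      (fun w _ hw' => ⟨rfl, hp w hw'⟩) h).2
    intro w hw
    rcases mem_insert.1 hw with rfl | hw
    · exact hu
    · exact h1 w hw

/-- occupied set after the drivers in `D` have parked in increasing order -/
def run (p s : Fin n → Fin n) (D : Finset (Fin n)) : Finset (Fin n) :=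
  (D.sort (fun a b => b ≤ a)).foldr (fun i O => treeStep p O (s i)) ∅

lemma run_empty (p s : Fin n → Fin n) : run p s ∅ = ∅ := by
  simp [run]

lemma run_insert (p s : Fin n → Fin n) {D : Finset (Fin n)} {m : Fin n} (h : ∀ j ∈ D, j < m) :
    run p s (insert m D) = treeStep p (run p s D) (s m) := by
  unfold run
  rw [Finset.sort_insert (r := fun a b => b ≤ a) (fun b hb => (h b hb).le)
    (fun hm => lt_irrefl _ (h m hm))]
  rfl

lemma run_card_le (p s : Fin n → Fin n) (D : Finset (Fin n)) : #(run p s D) ≤ #D := by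
  induction D using Finset.induction_on_max with
  | empty => simp [run_empty]
  | insert m D h ih =>
    rw [run_insert p s h, card_insert_of_notMem (fun hm => lt_irrefl _ (h m hm))]
    cases hs : parkSpot p (run p s D) (s m) with
    | none => rw [treeStep_none hs]; omega
    | some u => rw [treeStep_some hs]; exact (card_insert_le _ _).trans (by omega)

lemma run_congr {p p' s s' : Fin n → Fin n} {D : Finset (Fin n)} {O : Finset (Fin n)}
    (hO : run p s D ⊆ O) (hp : ∀ w ∈ O, p' w = p w) (hs : ∀ i ∈ D, s' i = s i) :
    run p' s' D = run p s D := by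
  induction D using Finset.induction_on_max with
  | empty => simp [run_empty]
  | insert m D h ih =>
    rw [run_insert p s h] at hO
    have hO' := (subset_treeStep _ _ _).trans hO
    have ih' := ih hO' (fun i hi => hs i (mem_insert_of_mem hi))
    rw [run_insert p s h, run_insert p' s' h, ih', hs m (mem_insert_self _ _)]
    have := spot_congr (p := p) (p' := p') (O := run p s D) (O' := run p s D) (v := s m) Set.univ
      trivial (fun _ _ => Iff.rfl) (fun w _ hw => ⟨hp w (hO' hw), trivial⟩)
    unfold treeStep
    rw [this]

lemma run_split {p s : Fin n → Fin n} {D : Finset (Fin n)} {O : Finset (Fin n)}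
    (A : Finset (Fin n)) (hA : ∀ w ∈ O, (w ∈ A ↔ p w ∈ A))
    (hO : run p s D ⊆ O ∨ run p s {i ∈ D | s i ∈ A} ∪ run p s {i ∈ D | s i ∉ A} ⊆ O) :
    run p s D = run p s {i ∈ D | s i ∈ A} ∪ run p s {i ∈ D | s i ∉ A} ∧
      (∀ w ∈ run p s {i ∈ D | s i ∈ A}, w ∈ A) ∧ (∀ w ∈ run p s {i ∈ D | s i ∉ A}, w ∉ A) := by
  induction D using Finset.induction_on_max with
  | empty => simp [run_empty]
  | insert m D h ih =>
    have h1 : ∀ j ∈ ({i ∈ D | s i ∈ A} : Finset _), j < m := fun j hj => h j (mem_filter.1 hj).1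
    have h2 : ∀ j ∈ ({i ∈ D | s i ∉ A} : Finset _), j < m := fun j hj => h j (mem_filter.1 hj).1
    by_cases hm : s m ∈ A
    · have e1 : ({i ∈ insert m D | s i ∈ A} : Finset _) = insert m {i ∈ D | s i ∈ A} := by
        rw [filter_insert, if_pos hm]
      have e2 : ({i ∈ insert m D | s i ∉ A} : Finset _) = {i ∈ D | s i ∉ A} := by
        rw [filter_insert, if_neg (by simpa using hm)]
      rw [e1, e2, run_insert p s h1, run_insert p s h] at hO
      rw [e1, e2, run_insert p s h1, run_insert p s h]
      have hO' : run p s D ⊆ O ∨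
          run p s {i ∈ D | s i ∈ A} ∪ run p s {i ∈ D | s i ∉ A} ⊆ O :=
        hO.imp (fun hh => (subset_treeStep _ _ _).trans hh)
          (fun hh => (union_subset_union_left (subset_treeStep _ _ _)).trans hh)
      obtain ⟨i1, i2, i3⟩ := ih hO'
      have hsub : run p s {i ∈ D | s i ∈ A} ∪ run p s {i ∈ D | s i ∉ A} ⊆ O := by
        rcases hO' with hh | hh
        · rwa [← i1]
        · exact hh
      have := treeStep_union (p := p) (O₁ := run p s {i ∈ D | s i ∈ A})
        (O₂ := run p s {i ∈ D | s i ∉ A}) (v := s m) {w | w ∈ A} hm i2 i3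
        (fun w hw => (hA w (hsub (mem_union_left _ hw))).1 (i2 w hw))
      rw [i1]
      exact ⟨this.1, this.2, i3⟩
    · have e1 : ({i ∈ insert m D | s i ∈ A} : Finset _) = {i ∈ D | s i ∈ A} := by
        rw [filter_insert, if_neg hm]
      have e2 : ({i ∈ insert m D | s i ∉ A} : Finset _) = insert m {i ∈ D | s i ∉ A} := by
        rw [filter_insert, if_pos hm]
      rw [e1, e2, run_insert p s h2, run_insert p s h] at hO
      rw [e1, e2, run_insert p s h2, run_insert p s h]
      have hO' : run p s D ⊆ O ∨
          run p s {i ∈ D | s i ∈ A} ∪ run p s {i ∈ D | s i ∉ A} ⊆ O :=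
        hO.imp (fun hh => (subset_treeStep _ _ _).trans hh)
          (fun hh => (union_subset_union_right (subset_treeStep _ _ _)).trans hh)
      obtain ⟨i1, i2, i3⟩ := ih hO'
      have hsub : run p s {i ∈ D | s i ∈ A} ∪ run p s {i ∈ D | s i ∉ A} ⊆ O := by
        rcases hO' with hh | hh
        · rwa [← i1]
        · exact hh
      have := treeStep_union (p := p) (O₁ := run p s {i ∈ D | s i ∉ A})
        (O₂ := run p s {i ∈ D | s i ∈ A}) (v := s m) {w | w ∉ A} hm i3
        (fun w hw => by simpa using i2 w hw)
        (fun w hw => fun hc => i3 w hw ((hA w (hsub (mem_union_right _ hw))).2 hc))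
      rw [i1, union_comm, union_comm (run p s {i ∈ D | s i ∈ A})]
      exact ⟨this.1, i2, this.2⟩

lemma occAfter_eq_run (p s : Fin n → Fin n) (k : ℕ) (hk : k ≤ n) :
    occAfter p s k = run p s (univ.filter fun i : Fin n => (i : ℕ) < k) := by
  induction k with
  | zero => simp [occAfter, run_empty]
  | succ k ih =>
    have e : (univ.filter fun i : Fin n => (i : ℕ) < k + 1) =
        insert ⟨k, hk⟩ (univ.filter fun i : Fin n => (i : ℕ) < k) := by
      ext i
      simp [Fin.ext_iff]
      omega
    rw [e, run_insert, ← ih (by omega)]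
    · unfold occAfter
      have hk' : k < (List.ofFn s).length := by simpa using hk
      rw [List.take_succ_eq_append_getElem hk', List.foldl_append]
      simp
    · intro j hj
      simpa [Fin.lt_def] using hj

lemma isTreePF_iff (p s : Fin n → Fin n) : IsTreePF p s ↔ run p s univ = univ := by
  unfold IsTreePF
  rw [occAfter_eq_run p s n le_rfl]
  simp

/-- target occupied set -/
def tgt (c : Bool) (V : Finset (Fin n)) (r : Fin n) : Finset (Fin n) :=
  if c then V else V.erase r

lemma mem_tgt {c : Bool} {V : Finset (Fin n)} {r w : Fin n} :
    w ∈ tgt c V r ↔ w ∈ V ∧ (c = true ∨ w ≠ r) := by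
  cases c <;> simp [tgt, and_comm]

/-- rooted tree on `V` with drivers `D`; the drivers fill the whole tree
(`c = true`), or everything but the root (`c = false`). -/
structure IsS (d : Fin n) (c : Bool) (V D : Finset (Fin n)) (r : Fin n) (p s : Fin n → Fin n) :
    Prop where
  r_mem : r ∈ V
  p_r : p r = r
  p_out : ∀ v, v ∉ V → p v = v
  p_in : ∀ v ∈ V, p v ∈ V
  tree : ∀ v ∈ V, ∃ k, p^[k] v = r
  s_in : ∀ i ∈ D, s i ∈ V
  s_out : ∀ i, i ∉ D → s i = d
  card : #D = #(tgt c V r)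
  park : run p s D = tgt c V r

lemma reach_congr {p p' : Fin n → Fin n} {r : Fin n} (Q : Finset (Fin n))
    (hp : ∀ w ∈ Q, w ≠ r → p' w = p w ∧ p w ∈ Q) (k : ℕ) (v : Fin n) (hv : v ∈ Q)
    (h : p^[k] v = r) : ∃ k, p'^[k] v = r := by
  induction k generalizing v with
  | zero => exact ⟨0, h⟩
  | succ k ih =>
    by_cases hr : v = r
    · exact ⟨0, hr⟩
    · obtain ⟨h1, h2⟩ := hp v hv hr
      obtain ⟨k', hk'⟩ := ih (p v) h2 h
      exact ⟨k' + 1, by rw [Function.iterate_succ_apply, h1, hk']⟩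

lemma iter_mem {p : Fin n → Fin n} {Q : Finset (Fin n)} (hp : ∀ w ∈ Q, p w ∈ Q) (k : ℕ)
    (v : Fin n) (hv : v ∈ Q) : p^[k] v ∈ Q := by
  induction k generalizing v with
  | zero => exact hv
  | succ k ih => exact ih _ (hp v hv)

open Classical in
/-- vertices of `V` from which `z` can be reached -/
noncomputable def desc (V : Finset (Fin n)) (p : Fin n → Fin n) (z : Fin n) : Finset (Fin n) :=
  {u ∈ V | ∃ k, p^[k] u = z}

def glueP (A : Finset (Fin n)) (ra y : Fin n) (pa pb : Fin n → Fin n) (v : Fin n) : Fin n :=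
  if v = ra then y else if v ∈ A then pa v else pb v

def glueS (DA : Finset (Fin n)) (m x : Fin n) (sa sb : Fin n → Fin n) (i : Fin n) : Fin n :=
  if i = m then x else if i ∈ DA then sa i else sb i

lemma glue {d : Fin n} {c : Bool} {A B DA DB : Finset (Fin n)} {m ra rb x y : Fin n}
    {pa sa pb sb : Fin n → Fin n} (hAB : Disjoint A B) (hD : Disjoint DA DB)
    (hm : ∀ j ∈ DA ∪ DB, j < m) (ha : IsS d false A DA ra pa sa) (hb : IsS d c B DB rb pb sb)
    (hx : x ∈ A) (hy : y ∈ B) :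
    IsS d c (A ∪ B) (insert m (DA ∪ DB)) rb (glueP A ra y pa pb) (glueS DA m x sa sb) ∧
    parkSpot (glueP A ra y pa pb) (run (glueP A ra y pa pb) (glueS DA m x sa sb) (DA ∪ DB))
      (glueS DA m x sa sb m) = some ra ∧ ra ≠ rb ∧
    desc (A ∪ B) (glueP A ra y pa pb) ra = A ∧
    {i ∈ DA ∪ DB | glueS DA m x sa sb i ∈ A} = DA := by
  have hdis : ∀ w, w ∈ A → w ∉ B := fun w h1 h2 => disjoint_left.1 hAB h1 h2
  have hDdis : ∀ w, w ∈ DA → w ∉ DB := fun w h1 h2 => disjoint_left.1 hD h1 h2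
  set p := glueP A ra y pa pb with hp
  set s := glueS DA m x sa sb with hs
  have pra : p ra = y := by simp [hp, glueP]
  have pA : ∀ w ∈ A, w ≠ ra → p w = pa w := by
    intro w hw hne; simp [hp, glueP, hw, hne]
  have pB : ∀ w, w ∉ A → p w = pb w := by
    intro w hw
    have : w ≠ ra := fun h => hw (h ▸ ha.r_mem)
    simp [hp, glueP, hw, this]
  have hmm : m ∉ DA ∪ DB := fun h => lt_irrefl _ (hm m h)
  have sm : s m = x := by simp [hs, glueS]
  have sA : ∀ i ∈ DA, s i = sa i := by
    intro i hi
    have : i ≠ m := fun h => hmm (h ▸ mem_union_left _ hi)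
    simp [hs, glueS, hi, this]
  have sB : ∀ i, i ∉ DA → i ≠ m → s i = sb i := by
    intro i hi hne
    simp [hs, glueS, hi, hne]
  have hne : ra ≠ rb := fun h => hdis _ ha.r_mem (h ▸ hb.r_mem)
  have reachA : ∀ v ∈ A, ∃ k, p^[k] v = ra := by
    intro v hv
    obtain ⟨k, hk⟩ := ha.tree v hv
    exact reach_congr A (fun w hw hne => ⟨pA w hw hne, ha.p_in w hw⟩) k v hv hk
  have reachB : ∀ v ∈ B, ∃ k, p^[k] v = rb := by
    intro v hv
    obtain ⟨k, hk⟩ := hb.tree v hv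
    exact reach_congr B (fun w hw _ => ⟨pB w (fun h => hdis _ h hw), hb.p_in w hw⟩) k v hv hk
  have pBB : ∀ w ∈ B, p w ∈ B := by
    intro w hw
    rw [pB w (fun h => hdis _ h hw)]
    exact hb.p_in w hw
  have fD : ({i ∈ DA ∪ DB | s i ∈ A} : Finset _) = DA := by
    ext i
    simp only [mem_filter, mem_union]
    constructor
    · rintro ⟨hi | hi, h⟩
      · exact hi
      · exfalso
        have h1 : i ∉ DA := fun h => hDdis _ h hi
        rw [sB i h1 (fun h => hmm (h ▸ mem_union_right _ hi))] at h
        exact hdis _ h (hb.s_in i hi)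
    · intro hi
      exact ⟨Or.inl hi, by rw [sA i hi]; exact ha.s_in i hi⟩
  have fD' : ({i ∈ DA ∪ DB | s i ∉ A} : Finset _) = DB := by
    rw [filter_not, fD, union_sdiff_left]
    exact sdiff_eq_self_of_disjoint hD.symm
  have runA : run p s DA = A.erase ra := by
    have h1 : run pa sa DA = A.erase ra := ha.park
    rw [← h1]
    refine run_congr (O := A.erase ra) h1.subset ?_ sA
    intro w hw
    exact pA w (mem_of_mem_erase hw) (ne_of_mem_erase hw)
  have runB : run p s DB = tgt c B rb := by
    rw [← hb.park]
    refine run_congr (O := B) ?_ ?_ ?_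
    · rw [hb.park]
      intro w hw
      exact (mem_tgt.1 hw).1
    · intro w hw
      exact pB w (fun h => hdis _ h hw)
    · intro i hi
      exact sB i (fun h => hDdis _ h hi) (fun h => hmm (h ▸ mem_union_right _ hi))
  have runD : run p s (DA ∪ DB) = A.erase ra ∪ tgt c B rb := by
    have := (run_split (p := p) (s := s) (D := DA ∪ DB) (O := A.erase ra ∪ tgt c B rb) A ?_ ?_).1
    · rw [this, fD, fD', runA, runB]
    · intro w hw
      rcases mem_union.1 hw with h | h
      · have h1 := mem_of_mem_erase h
        rw [pA w h1 (ne_of_mem_erase h)]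
        exact ⟨fun _ => ha.p_in w h1, fun _ => h1⟩
      · have h1 := (mem_tgt.1 h).1
        exact ⟨fun h2 => absurd h1 (hdis _ h2), fun h2 => absurd (pBB w h1) (hdis _ h2)⟩
    · right
      rw [fD, fD', runA, runB]
  have rbA : rb ∉ A := fun h => hdis _ h hb.r_mem
  have hspot : parkSpot p (run p s (DA ∪ DB)) (s m) = some ra := by
    rw [sm, runD, parkSpot_eq_some]
    obtain ⟨k, hk, h1, h2⟩ := exists_short (reachA x hx)
    refine ⟨k, hk, h1, ?_, ?_⟩
    · simp only [mem_union, mem_erase, mem_tgt]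
      have := hdis _ ha.r_mem
      tauto
    · have key : ∀ j, j ≤ k → p^[j] x ∈ A := by
        intro j
        induction j with
        | zero => intro _; exact hx
        | succ j ih =>
          intro hj
          have i1 := ih (by omega)
          rw [Function.iterate_succ_apply', pA _ i1 (h2 j (by omega))]
          exact ha.p_in _ i1
      intro j hj
      exact mem_union_left _ (mem_erase.2 ⟨h2 j hj, key j hj.le⟩)
  have htgt : tgt c (A ∪ B) rb = A ∪ tgt c B rb := by
    ext w
    simp only [mem_tgt, mem_union]
    have : w ∈ A → w ≠ rb := fun h h' => rbA (h' ▸ h)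
    tauto
  have hdt : Disjoint A (tgt c B rb) := by
    rw [disjoint_left]
    intro w hw hw'
    exact hdis _ hw (mem_tgt.1 hw').1
  refine ⟨?_, hspot, hne, ?_, fD⟩
  · refine ⟨mem_union_right _ hb.r_mem, ?_, ?_, ?_, ?_, ?_, ?_, ?_, ?_⟩
    · rw [pB rb rbA, hb.p_r]
    · intro v hv
      rw [mem_union, not_or] at hv
      rw [pB v hv.1, hb.p_out v hv.2]
    · intro v hv
      rcases mem_union.1 hv with h | h
      · by_cases h1 : v = ra
        · rw [h1, pra]; exact mem_union_right _ hy
        · rw [pA v h h1]; exact mem_union_left _ (ha.p_in v h)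
      · exact mem_union_right _ (pBB v h)
    · intro v hv
      rcases mem_union.1 hv with h | h
      · obtain ⟨k, hk⟩ := reachA v h
        obtain ⟨l, hl⟩ := reachB y hy
        refine ⟨l + (k + 1), ?_⟩
        rw [Function.iterate_add_apply, Function.iterate_succ_apply', hk, pra, hl]
      · exact reachB v h
    · intro i hi
      by_cases h1 : i = m
      · rw [h1, sm]; exact mem_union_left _ hx
      · have := mem_of_mem_insert_of_ne hi h1
        by_cases h2 : i ∈ DA
        · rw [sA i h2]; exact mem_union_left _ (ha.s_in i h2)
        · rw [sB i h2 h1]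
          exact mem_union_right _ (hb.s_in i ((mem_union.1 this).resolve_left h2))
    · intro i hi
      simp only [mem_insert, mem_union, not_or] at hi
      rw [sB i hi.2.1 hi.1, hb.s_out i hi.2.2]
    · rw [card_insert_of_notMem hmm, card_union_of_disjoint hD, htgt, card_union_of_disjoint hdt,
        hb.card, ha.card]
      have : #(tgt false A ra) + 1 = #A := by
        simpa [tgt] using card_erase_add_one ha.r_mem
      omega
    · rw [run_insert p s hm, treeStep_some hspot, runD, htgt, ← insert_union,
        insert_erase ha.r_mem]
  · ext u
    simp only [desc, mem_filter, mem_union]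
    constructor
    · rintro ⟨h | h, k, hk⟩
      · exact h
      · exact absurd (hk ▸ iter_mem pBB k u h) (hdis _ ha.r_mem)
    · intro h
      exact ⟨Or.inl h, reachA u h⟩

lemma last_spot {d : Fin n} {c : Bool} {V D : Finset (Fin n)} {m r : Fin n} {p s : Fin n → Fin n}
    (hm : ∀ j ∈ D, j < m) (h : IsS d c V (insert m D) r p s) :
    ∃ z, parkSpot p (run p s D) (s m) = some z ∧ z ∈ tgt c V r ∧
      run p s D = (tgt c V r).erase z := by
  have hmm : m ∉ D := fun h => lt_irrefl _ (hm m h)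
  have h1 := h.park
  have h2 := h.card
  rw [card_insert_of_notMem hmm] at h2
  rw [run_insert p s hm] at h1
  cases hz : parkSpot p (run p s D) (s m) with
  | none =>
    rw [treeStep_none hz] at h1
    have := run_card_le p s D
    rw [h1] at this
    omega
  | some z =>
    rw [treeStep_some hz] at h1
    refine ⟨z, rfl, ?_, ?_⟩
    · rw [← h1]; exact mem_insert_self _ _
    · rw [← h1, erase_insert]
      obtain ⟨_, _, _, h3, _⟩ := parkSpot_eq_some.1 hz
      exact h3

set_option maxHeartbeats 1000000 in
lemma unglue {d : Fin n} {c : Bool} {V D : Finset (Fin n)} {m r z : Fin n} {p s : Fin n → Fin n}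
    (hm : ∀ j ∈ D, j < m) (h : IsS d c V (insert m D) r p s)
    (hz : parkSpot p (run p s D) (s m) = some z) (hzr : z ≠ r) (A DA : Finset (Fin n))
    (hA : desc V p z = A) (hDA : {i ∈ D | s i ∈ A} = DA) :
    ∃ pa sa pb sb : Fin n → Fin n, ∃ x y : Fin n, IsS d false A DA z pa sa ∧
      IsS d c (V \ A) (D \ DA) r pb sb ∧ x ∈ A ∧ y ∈ V \ A ∧
      glueP A z y pa pb = p ∧ glueS DA m x sa sb = s := by
  obtain ⟨z', hz', hzt, hrun⟩ := last_spot hm h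
  obtain rfl : z' = z := by rw [hz] at hz'; exact (Option.some.inj hz').symm
  have hmm : m ∉ D := fun h => lt_irrefl _ (hm m h)
  have memA : ∀ u, u ∈ A ↔ u ∈ V ∧ ∃ k, p^[k] u = z' := by
    intro u; rw [← hA]; simp [desc]
  have hzV : z' ∈ V := (mem_tgt.1 hzt).1
  have hzA : z' ∈ A := (memA _).2 ⟨hzV, 0, rfl⟩
  have pA : ∀ u ∈ A, u ≠ z' → p u ∈ A := by
    intro u hu hne
    obtain ⟨hV, k, hk⟩ := (memA _).1 hu
    refine (memA _).2 ⟨h.p_in u hV, ?_⟩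
    rcases k with _ | k
    · exact absurd hk hne
    · exact ⟨k, hk⟩
  have pA' : ∀ u ∈ V, p u ∈ A → u ∈ A := by
    intro u hu hp
    obtain ⟨_, k, hk⟩ := (memA _).1 hp
    exact (memA _).2 ⟨hu, k + 1, hk⟩
  have hrfix : ∀ k, p^[k] r = r := fun k => Function.iterate_fixed h.p_r k
  have hrA : r ∉ A := by
    intro hr
    obtain ⟨_, k, hk⟩ := (memA _).1 hr
    rw [hrfix] at hk
    exact hzr hk.symm
  have pz : p z' ∉ A := by
    intro hc
    obtain ⟨_, k, hk⟩ := (memA _).1 hc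
    obtain ⟨K, hK⟩ := h.tree z' hzV
    have h1 : p^[k + 1] z' = z' := hk
    have h2 : p^[(k + 1) * K] z' = z' := by
      rw [Function.iterate_mul]
      exact Function.iterate_fixed h1 K
    have h3 : p^[(k + 1) * K] z' = r := by
      rw [show (k + 1) * K = k * K + K by ring, Function.iterate_add_apply, hK, hrfix]
    exact hzr (h2.symm.trans h3)
  have hsA : s m ∈ A := by
    obtain ⟨k, _, hk, _⟩ := parkSpot_eq_some.1 hz
    exact (memA _).2 ⟨h.s_in m (mem_insert_self _ _), k, hk⟩
  have htV : ∀ w ∈ tgt c V r, w ∈ V := fun w hw => (mem_tgt.1 hw).1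
  obtain ⟨s1, s2, s3⟩ := run_split (p := p) (s := s) (D := D) (O := (tgt c V r).erase z') A
    (by
      intro w hw
      exact ⟨fun h1 => pA w h1 (ne_of_mem_erase hw),
        fun h1 => pA' w (htV _ (mem_of_mem_erase hw)) h1⟩) (Or.inl hrun.subset)
  have fD' : ({i ∈ D | s i ∉ A} : Finset _) = D \ DA := by
    rw [filter_not, hDA]
  rw [fD', hDA, hrun] at s1
  rw [hDA] at s2
  rw [fD'] at s3
  have hAV : A ⊆ V := fun w hw => ((memA w).1 hw).1
  have htgt : tgt c V r = A ∪ tgt c (V \ A) r := by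
    ext w
    simp only [mem_tgt, mem_union, mem_sdiff]
    have h1 : w ∈ A → w ≠ r := fun h h' => hrA (h' ▸ h)
    have h2 := @hAV w
    tauto
  have hdt : Disjoint A (tgt c (V \ A) r) := by
    rw [disjoint_left]
    intro w hw hw'
    exact (mem_sdiff.1 (mem_tgt.1 hw').1).2 hw
  have runA : run p s DA = A.erase z' := by
    ext w
    have h1 := congrArg (w ∈ ·) s1
    simp only [htgt, mem_erase, mem_union, eq_iff_iff] at h1 ⊢
    have h2 := s2 w
    have h3 := s3 w
    have h4 : w ∈ A → w ∉ tgt c (V \ A) r := fun h => disjoint_left.1 hdt h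
    tauto
  have runB : run p s (D \ DA) = tgt c (V \ A) r := by
    ext w
    have h1 := congrArg (w ∈ ·) s1
    simp only [htgt, mem_erase, mem_union, eq_iff_iff] at h1 ⊢
    have h2 := s2 w
    have h3 := s3 w
    have h4 : w ∈ A → w ∉ tgt c (V \ A) r := fun h => disjoint_left.1 hdt h
    have h5 : w = z' → w ∈ A := fun h => h ▸ hzA
    tauto
  have cA := run_card_le p s DA
  have cB := run_card_le p s (D \ DA)
  have hDAD : DA ⊆ D := hDA ▸ filter_subset _ _
  have cD := card_sdiff_add_card_eq_card hDAD
  have ct := h.card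
  rw [card_insert_of_notMem hmm, htgt, card_union_of_disjoint hdt] at ct
  rw [runA] at cA
  rw [runB] at cB
  have cz := card_erase_add_one hzA
  have sDA : ∀ i ∈ DA, s i ∈ A := by
    intro i hi
    rw [← hDA] at hi
    exact (mem_filter.1 hi).2
  have sDB : ∀ i ∈ D \ DA, s i ∉ A := by
    intro i hi
    rw [← fD'] at hi
    exact (mem_filter.1 hi).2
  have hBp : ∀ v ∈ V \ A, p v ∈ V \ A := by
    intro v hv
    obtain ⟨h1, h2⟩ := mem_sdiff.1 hv
    exact mem_sdiff.2 ⟨h.p_in v h1, fun h3 => h2 (pA' v h1 h3)⟩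
  refine ⟨fun v => if v ∈ A ∧ v ≠ z' then p v else v, fun i => if i ∈ DA then s i else d,
    fun v => if v ∈ A then v else p v, fun i => if i ∈ D \ DA then s i else d,
    s m, p z', ?_, ?_, hsA, mem_sdiff.2 ⟨h.p_in _ hzV, pz⟩, ?_, ?_⟩
  · refine ⟨hzA, by simp, ?_, ?_, ?_, ?_, ?_, ?_, ?_⟩
    · intro v hv; simp [hv]
    · intro v hv
      by_cases h1 : v = z'
      · simp [h1, hzA]
      · simpa [hv, h1] using pA v hv h1
    · intro v hv
      obtain ⟨_, k, hk⟩ := (memA v).1 hv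
      refine reach_congr A (fun w hw hne => ⟨?_, pA w hw hne⟩) k v hv hk
      simp [hw, hne]
    · intro i hi
      simpa [hi] using sDA i hi
    · intro i hi; simp [hi]
    · show #DA = #(A.erase z')
      omega
    · show _ = A.erase z'
      rw [← runA]
      refine run_congr (O := A.erase z') runA.subset ?_ ?_
      · intro w hw
        simp [mem_of_mem_erase hw, ne_of_mem_erase hw]
      · intro i hi; simp [hi]
  · refine ⟨mem_sdiff.2 ⟨h.r_mem, hrA⟩, by simp [h.p_r], ?_, ?_, ?_, ?_, ?_, ?_, ?_⟩
    · intro v hv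
      by_cases h1 : v ∈ A
      · simp [h1]
      · simp only [h1, if_false]
        exact h.p_out v (fun h2 => hv (mem_sdiff.2 ⟨h2, h1⟩))
    · intro v hv
      simp only [(mem_sdiff.1 hv).2, if_false]
      exact hBp v hv
    · intro v hv
      obtain ⟨k, hk⟩ := h.tree v (mem_sdiff.1 hv).1
      refine reach_congr (V \ A) (fun w hw _ => ⟨?_, hBp w hw⟩) k v hv hk
      simp [(mem_sdiff.1 hw).2]
    · intro i hi
      simp only [hi, if_true]
      exact mem_sdiff.2 ⟨h.s_in i (mem_insert_of_mem (mem_sdiff.1 hi).1), sDB i hi⟩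
    · intro i hi; simp only [hi, if_false]
    · omega
    · rw [← runB]
      refine run_congr (O := tgt c (V \ A) r) runB.subset ?_ ?_
      · intro w hw
        simp [(mem_sdiff.1 (mem_tgt.1 hw).1).2]
      · intro i hi; simp only [hi, if_true]
  · funext v
    unfold glueP
    by_cases h1 : v = z'
    · simp [h1]
    · by_cases h2 : v ∈ A <;> simp [h1, h2]
  · funext i
    unfold glueS
    by_cases h1 : i = m
    · simp [h1]
    · by_cases h2 : i ∈ DA
      · simp [h1, h2]
      · by_cases h3 : i ∈ D
        · simp [h1, h2, h3]
        · simp only [h1, h2, if_false]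
          rw [if_neg (fun h => h3 (mem_sdiff.1 h).1)]
          exact (h.s_out i (by simp [h1, h3])).symm

abbrev Tri (n : ℕ) := Fin n × (Fin n → Fin n) × (Fin n → Fin n)

open Classical in
noncomputable def S (d : Fin n) (c : Bool) (V D : Finset (Fin n)) : Finset (Tri n) :=
  univ.filter fun x => IsS d c V D x.1 x.2.1 x.2.2

lemma mem_S {d : Fin n} {c : Bool} {V D : Finset (Fin n)} {x : Tri n} :
    x ∈ S d c V D ↔ IsS d c V D x.1 x.2.1 x.2.2 := by
  simp [S]

/-- spot of the last driver -/
def spot (D : Finset (Fin n)) (m : Fin n) (x : Tri n) : Option (Fin n) :=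
  parkSpot x.2.1 (run x.2.1 x.2.2 D) (x.2.2 m)

/-- splitting data -/
noncomputable def key (V D : Finset (Fin n)) (m : Fin n) (x : Tri n) :
    Finset (Fin n) × Finset (Fin n) :=
  (desc V x.2.1 ((spot D m x).getD x.1),
    {i ∈ D | x.2.2 i ∈ desc V x.2.1 ((spot D m x).getD x.1)})

lemma card_fiber (d : Fin n) (c : Bool) (V D : Finset (Fin n)) (m : Fin n) (hm : ∀ j ∈ D, j < m)
    (A DA : Finset (Fin n)) (hAV : A ⊆ V) (hDAD : DA ⊆ D) :
    #{x ∈ (S d c V (insert m D)).filter (fun x => spot D m x ≠ some x.1) | key V D m x = (A, DA)} =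
      #(S d false A DA) * #A * (#(S d c (V \ A) (D \ DA)) * #(V \ A)) := by
  rw [← card_product, ← card_product, ← card_product]
  symm
  have hV : A ∪ (V \ A) = V := union_sdiff_of_subset hAV
  have hD : DA ∪ (D \ DA) = D := union_sdiff_of_subset hDAD
  have G : ∀ a ∈ (S d false A DA ×ˢ A) ×ˢ (S d c (V \ A) (D \ DA) ×ˢ (V \ A)), _ :=
    fun a ha => by
      simp only [mem_product, mem_S] at ha
      have := glue (m := m) (disjoint_sdiff (s := A) (t := V)) (disjoint_sdiff (s := DA) (t := D))
        (by rw [hD]; exact hm) ha.1.1 ha.2.1 ha.1.2 ha.2.2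
      rw [hV, hD] at this
      exact this
  refine card_bij (fun a _ => (a.2.1.1,
    glueP A a.1.1.1 a.2.2 a.1.1.2.1 a.2.1.2.1, glueS DA m a.1.2 a.1.1.2.2 a.2.1.2.2)) ?_ ?_ ?_
  · intro a ha
    obtain ⟨g1, g2, g3, g4, g5⟩ := G a ha
    have hsp : spot D m (a.2.1.1, glueP A a.1.1.1 a.2.2 a.1.1.2.1 a.2.1.2.1,
        glueS DA m a.1.2 a.1.1.2.2 a.2.1.2.2) = some a.1.1.1 := g2
    rw [mem_filter, mem_filter, mem_S]
    refine ⟨⟨g1, ?_⟩, ?_⟩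
    · rw [hsp]
      simpa using g3
    · unfold key
      rw [hsp]
      simp only [Option.getD_some]
      rw [g4, g5]
  · intro a ha b hb hab
    obtain ⟨g1, g2, g3, g4, g5⟩ := G a ha
    obtain ⟨k1, k2, k3, k4, k5⟩ := G b hb
    simp only [mem_product, mem_S] at ha hb
    obtain ⟨⟨⟨ra, pa, sa⟩, x⟩, ⟨⟨rb, pb, sb⟩, y⟩⟩ := a
    obtain ⟨⟨⟨ra', pa', sa'⟩, x'⟩, ⟨⟨rb', pb', sb'⟩, y'⟩⟩ := b
    simp only [Prod.mk.injEq] at *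
    obtain ⟨⟨ha, hx⟩, hb', hy⟩ := ha
    obtain ⟨⟨ha', hx'⟩, hb'', hy'⟩ := hb
    obtain ⟨e1, e2, e3⟩ := hab
    rw [← e2, ← e3, g2] at k2
    have era : ra = ra' := Option.some.inj k2
    subst era e1
    have hmm : m ∉ D := fun h => lt_irrefl _ (hm m h)
    have ex : x = x' := by
      have := congrFun e3 m
      simpa [glueS] using this
    have ey : y = y' := by
      have := congrFun e2 ra
      simpa [glueP] using this
    have epa : pa = pa' := by
      funext v
      by_cases h1 : v = ra
      · rw [h1, ha.p_r, ha'.p_r]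
      · by_cases h2 : v ∈ A
        · have := congrFun e2 v
          simpa [glueP, h1, h2] using this
        · rw [ha.p_out v h2, ha'.p_out v h2]
    have epb : pb = pb' := by
      funext v
      by_cases h2 : v ∈ A
      · rw [hb'.p_out v (by simp [h2]), hb''.p_out v (by simp [h2])]
      · have := congrFun e2 v
        have h1 : v ≠ ra := fun h => h2 (h ▸ ha.r_mem)
        simpa [glueP, h1, h2] using this
    have esa : sa = sa' := by
      funext v
      by_cases h2 : v ∈ DA
      · have := congrFun e3 v
        have h1 : v ≠ m := fun h => hmm (h ▸ hDAD h2)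
        simpa [glueS, h1, h2] using this
      · rw [ha.s_out v h2, ha'.s_out v h2]
    have esb : sb = sb' := by
      funext v
      by_cases h2 : v ∈ D \ DA
      · have := congrFun e3 v
        have h1 : v ≠ m := fun h => hmm (h ▸ (mem_sdiff.1 h2).1)
        simpa [glueS, h1, (mem_sdiff.1 h2).2] using this
      · rw [hb'.s_out v h2, hb''.s_out v h2]
    simp [ex, ey, epa, epb, esa, esb]
  · rintro ⟨r, p, s⟩ hx
    rw [mem_filter, mem_filter, mem_S] at hx
    obtain ⟨⟨h1, h2⟩, h3⟩ := hx
    obtain ⟨z, hz, -, -⟩ := last_spot hm h1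
    have hsp : spot D m (r, p, s) = some z := hz
    unfold key at h3
    rw [hsp] at h2 h3
    simp only [Option.getD_some, Prod.mk.injEq] at h3
    have h3' := h3.2
    rw [h3.1] at h3'
    obtain ⟨pa, sa, pb, sb, x, y, u1, u2, u3, u4, u5, u6⟩ :=
      unglue hm h1 hz (by simpa using h2) A DA h3.1 h3'
    refine ⟨(((z, pa, sa), x), ((r, pb, sb), y)), ?_, ?_⟩
    · simp only [mem_product, mem_S]
      exact ⟨⟨u1, u3⟩, u2, u4⟩
    · simp only [u5, u6]

lemma card_root_true (d : Fin n) (V D : Finset (Fin n)) (m : Fin n) (hm : ∀ j ∈ D, j < m) :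
    #((S d true V (insert m D)).filter (fun x => spot D m x = some x.1)) =
      #(S d false V D) * #V := by
  have hmm : m ∉ D := fun h => lt_irrefl _ (hm m h)
  rw [← card_product]
  symm
  have hrun : ∀ (p s : Fin n → Fin n) (x : Fin n),
      run p (Function.update s m x) D = run p s D := by
    intro p s x
    refine run_congr (O := univ) (subset_univ _) (fun _ _ => rfl) ?_
    intro i hi
    have h1 : i ≠ m := fun h => hmm (h ▸ hi)
    rw [Function.update_of_ne h1]
  refine card_bij (fun a _ => (a.1.1, a.1.2.1, Function.update a.1.2.2 m a.2)) ?_ ?_ ?_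
  · rintro ⟨⟨r, p, s⟩, x⟩ ha
    simp only [mem_product, mem_S] at ha
    obtain ⟨h, hx⟩ := ha
    have hsp : spot D m (r, p, Function.update s m x) = some r := by
      show parkSpot p (run p (Function.update s m x) D) (Function.update s m x m) = some r
      rw [hrun, h.park, Function.update_self, parkSpot_eq_some]
      obtain ⟨k, hk, h1, h2⟩ := exists_short (h.tree x hx)
      refine ⟨k, hk, h1, by simp [mem_tgt], ?_⟩
      intro j hj
      rw [mem_tgt]
      exact ⟨iter_mem h.p_in j x hx, Or.inr (h2 j hj)⟩
    rw [mem_filter, mem_S]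
    refine ⟨⟨h.r_mem, h.p_r, h.p_out, h.p_in, h.tree, ?_, ?_, ?_, ?_⟩, hsp⟩
    · intro i hi
      by_cases h1 : i = m
      · simpa [h1] using hx
      · simpa [h1] using h.s_in i (mem_of_mem_insert_of_ne hi h1)
    · intro i hi
      simp only [mem_insert, not_or] at hi
      simpa [hi.1] using h.s_out i hi.2
    · rw [card_insert_of_notMem hmm, h.card]
      exact card_erase_add_one h.r_mem
    · show run p (Function.update s m x) (insert m D) = V
      rw [run_insert _ _ hm]
      have := treeStep_some (p := p) hsp
      simp only at this
      rw [this, hrun, h.park]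
      exact insert_erase h.r_mem
  · rintro ⟨⟨r, p, s⟩, x⟩ ha ⟨⟨r', p', s'⟩, x'⟩ hb hab
    simp only [mem_product, mem_S] at ha hb
    simp only [Prod.mk.injEq] at hab ⊢
    obtain ⟨e1, e2, e3⟩ := hab
    refine ⟨⟨e1, e2, ?_⟩, ?_⟩
    · funext i
      by_cases h1 : i = m
      · rw [h1, ha.1.s_out m hmm, hb.1.s_out m hmm]
      · have := congrFun e3 i
        simpa [h1] using this
    · have := congrFun e3 m
      simpa using this
  · rintro ⟨r, p, s⟩ hx
    rw [mem_filter, mem_S] at hx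
    obtain ⟨h, hsp⟩ := hx
    obtain ⟨z, hz, h2, h3⟩ := last_spot hm h
    have hsp' : spot D m (r, p, s) = some z := hz
    rw [hsp'] at hsp
    obtain rfl : z = r := by simpa using hsp
    refine ⟨((z, p, Function.update s m d), s m), ?_, ?_⟩
    · simp only [mem_product, mem_S]
      refine ⟨⟨h.r_mem, h.p_r, h.p_out, h.p_in, h.tree, ?_, ?_, ?_, ?_⟩,
        h.s_in m (mem_insert_self _ _)⟩
      · intro i hi
        have h1 : i ≠ m := fun h => hmm (h ▸ hi)
        simpa [h1] using h.s_in i (mem_insert_of_mem hi)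
      · intro i hi
        by_cases h1 : i = m
        · simp [h1]
        · simpa [h1] using h.s_out i (by simp [h1, hi])
      · have h4 := h.card
        rw [card_insert_of_notMem hmm] at h4
        have h5 : #(V.erase z) + 1 = #V := card_erase_add_one h.r_mem
        show #D = #(V.erase z)
        have h6 : #(tgt true V z) = #V := by simp [tgt]
        simp only at h4
        omega
      · rw [hrun, h3]
        simp [tgt]
    · simp

lemma card_root_false (d : Fin n) (V D : Finset (Fin n)) (m : Fin n) (hm : ∀ j ∈ D, j < m) :
    #((S d false V (insert m D)).filter (fun x => spot D m x = some x.1)) = 0 := by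
  rw [card_eq_zero, filter_eq_empty_iff]
  rintro ⟨r, p, s⟩ hx hsp
  rw [mem_S] at hx
  obtain ⟨z, hz, h2, h3⟩ := last_spot hm hx
  have hsp' : spot D m (r, p, s) = some z := hz
  rw [hsp'] at hsp
  obtain rfl : z = r := by simpa using hsp
  simp [mem_tgt] at h2

lemma card_S (d : Fin n) (c : Bool) (V D : Finset (Fin n)) (m : Fin n) (hm : ∀ j ∈ D, j < m) :
    #(S d c V (insert m D)) = (if c then #(S d false V D) * #V else 0) +
      ∑ A ∈ V.powerset, ∑ DA ∈ D.powerset,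
        #(S d false A DA) * #A * (#(S d c (V \ A) (D \ DA)) * #(V \ A)) := by
  rw [← card_filter_add_card_filter_not (s := S d c V (insert m D)) (fun x => spot D m x = some x.1)]
  congr 1
  · cases c
    · simpa using card_root_false d V D m hm
    · simpa using card_root_true d V D m hm
  · rw [← sum_product' (f := fun A DA => #(S d false A DA) * #A *
      (#(S d c (V \ A) (D \ DA)) * #(V \ A))),
      card_eq_sum_card_fiberwise (f := key V D m) (t := V.powerset ×ˢ D.powerset)]
    · refine sum_congr rfl ?_
      rintro ⟨A, DA⟩ h
      rw [mem_product, mem_powerset, mem_powerset] at h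
      exact card_fiber d c V D m hm A DA h.1 h.2
    · intro x _
      have hd : ∀ z, desc V x.2.1 z ⊆ V := fun z => by
        classical
        unfold desc; intro w hw; exact (mem_filter.1 hw).1
      simp only [coe_product, Set.mem_prod, mem_coe, mem_powerset, key]
      exact ⟨hd _, filter_subset _ _⟩

def ec (c : Bool) : ℕ := if c then 0 else 1

noncomputable def W (c : Bool) (N : ℕ) : ℚ :=
  if c then (Nat.factorial N : ℚ) * Nat.factorial (N - 1) * gc N
  else (Nat.factorial (N - 1) : ℚ) ^ 2 * yc N

lemma card_tgt {c : Bool} {V : Finset (Fin n)} {r : Fin n} (h : r ∈ V) :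
    #(tgt c V r) + ec c = #V := by
  cases c
  · simpa [tgt, ec] using card_erase_add_one h
  · simp [tgt, ec]

lemma S_zero (d : Fin n) (c : Bool) (V D : Finset (Fin n)) (h : #D + ec c ≠ #V) :
    #(S d c V D) = 0 := by
  rw [card_eq_zero, eq_empty_iff_forall_notMem]
  intro x hx
  rw [mem_S] at hx
  have h1 := card_tgt (c := c) hx.r_mem
  have h2 := hx.card
  omega

lemma W_zero (c : Bool) : W c 0 = 0 := by
  cases c <;> simp [W, yc, gc]

/-- factor collecting -/
def K (c : Bool) (N : ℕ) : ℚ := (Nat.factorial N : ℚ) * Nat.factorial (N - 1 - ec c)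

noncomputable def sq (c : Bool) (N : ℕ) : ℚ := if c then gc N else yc N

lemma term_eq (c : Bool) (N a b : ℕ) (h : a + b = N) :
    (N.choose a : ℚ) * ((N - 1 - ec c).choose (a - 1) * (W false a * a * (W c b * b))) =
      K c N * (yc a * sq c b) := by
  rcases a with _ | a
  · simp [yc]
  rcases b with _ | b
  · cases c <;> simp [sq, yc, gc]
  subst h
  have h1 : ((a + 1 + (b + 1)).choose (a + 1) : ℚ) * Nat.factorial (a + 1) * Nat.factorial (b + 1)
      = Nat.factorial (a + 1 + (b + 1)) := by
    rw [Nat.choose_symm_add]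
    exact_mod_cast Nat.add_choose_mul_factorial_mul_factorial (a + 1) (b + 1)
  cases c
  · have h2 : ((a + b).choose a : ℚ) * Nat.factorial a * Nat.factorial b
        = Nat.factorial (a + b) := by
      rw [Nat.choose_symm_add]
      exact_mod_cast Nat.add_choose_mul_factorial_mul_factorial a b
    simp only [K, W, sq, ec, Nat.add_sub_cancel, Bool.false_eq_true, if_false]
    rw [show a + 1 + (b + 1) - 1 - 1 = a + b by omega, ← h1, ← h2, Nat.factorial_succ a,
      Nat.factorial_succ b]
    push_cast
    ring
  · have h2 : ((a + (b + 1)).choose a : ℚ) * Nat.factorial a * Nat.factorial (b + 1)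
        = Nat.factorial (a + (b + 1)) := by
      rw [Nat.choose_symm_add]
      exact_mod_cast Nat.add_choose_mul_factorial_mul_factorial a (b + 1)
    simp only [K, W, sq, ec, Nat.add_sub_cancel, Bool.false_eq_true, if_false, if_true]
    rw [show a + 1 + (b + 1) - 1 - 0 = a + (b + 1) by omega, ← h1, ← h2, Nat.factorial_succ a,
      Nat.factorial_succ b]
    push_cast
    ring

lemma sum_eq (d : Fin n) (c : Bool) (V D : Finset (Fin n)) (hD : #D + 1 + ec c = #V)
    (IH : ∀ (c' : Bool) (V' D' : Finset (Fin n)), #V' < #V → #D' + ec c' = #V' →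
      (#(S d c' V' D') : ℚ) = W c' #V') :
    ∑ A ∈ V.powerset, ∑ DA ∈ D.powerset,
        ((#(S d false A DA) : ℚ) * #A * (#(S d c (V \ A) (D \ DA)) * #(V \ A))) =
      K c #V * ∑ ab ∈ antidiagonal #V, yc ab.1 * sq c ab.2 := by
  have inner : ∀ A ∈ V.powerset, ∑ DA ∈ D.powerset,
        ((#(S d false A DA) : ℚ) * #A * (#(S d c (V \ A) (D \ DA)) * #(V \ A))) =
      ((#V - 1 - ec c).choose (#A - 1) * (W false #A * #A * (W c (#V - #A) * (#V - #A : ℕ)))) := by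
    intro A hA
    rw [mem_powerset] at hA
    have cA := card_le_card hA
    have cB := card_sdiff_of_subset hA
    by_cases h0 : #A = 0
    · simp [h0]
    by_cases h1 : #A = #V
    · simp [cB, h1]
    have step : ∀ DA ∈ D.powerset,
        ((#(S d false A DA) : ℚ) * #A * (#(S d c (V \ A) (D \ DA)) * #(V \ A))) =
        (fun k => if k = #A - 1 then
          W false #A * #A * (W c (#V - #A) * (#V - #A : ℕ)) else 0) #DA := by
      intro DA hDA
      rw [mem_powerset] at hDA
      have c1 := card_le_card hDA
      have c2 := card_sdiff_of_subset hDA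
      by_cases h2 : #DA = #A - 1
      · simp only [h2, if_true]
        rw [IH false A DA (by omega) (by simp [ec]; omega),
          IH c (V \ A) (D \ DA) (by omega) (by omega), cB]
      · simp only [h2, if_false]
        rw [S_zero d false A DA (by simp [ec]; omega)]
        simp
    rw [sum_congr rfl step, sum_powerset_apply_card (fun k => if k = #A - 1 then
          W false #A * #A * (W c (#V - #A) * (#V - #A : ℕ)) else 0)]
    have hec : ec c ≤ 1 := by cases c <;> simp [ec]
    simp only [smul_ite, smul_zero]
    rw [sum_ite_eq', if_pos (by simp; omega), nsmul_eq_mul]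
    congr 3
    omega
  rw [sum_congr rfl inner]
  rw [sum_powerset_apply_card (fun k => (((#V - 1 - ec c).choose (k - 1) : ℚ) *
    (W false k * k * (W c (#V - k) * (#V - k : ℕ))))), mul_sum,
    Nat.sum_antidiagonal_eq_sum_range_succ_mk]
  refine sum_congr rfl ?_
  intro a ha
  simp at ha
  rw [nsmul_eq_mul]
  exact term_eq c #V a (#V - a) (by omega)

lemma S_one (d : Fin n) (V : Finset (Fin n)) (hV : #V = 1) : #(S d false V ∅) = 1 := by
  obtain ⟨r, rfl⟩ := card_eq_one.1 hV
  rw [card_eq_one]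
  refine ⟨(r, id, fun _ => d), ?_⟩
  ext ⟨r', p, s⟩
  rw [mem_S, mem_singleton]
  constructor
  · intro h
    have h1 := mem_singleton.1 h.r_mem
    simp only at h1
    subst h1
    simp only [Prod.mk.injEq, true_and]
    constructor
    · funext v
      by_cases h2 : v = r'
      · rw [h2]; exact h.p_r
      · exact h.p_out v (by simpa using h2)
    · funext i
      exact h.s_out i (by simp)
  · intro h
    simp only [Prod.mk.injEq] at h
    obtain ⟨rfl, rfl, rfl⟩ := h
    refine ⟨by simp, rfl, fun _ _ => rfl, by simp, ?_, by simp, fun _ _ => rfl, by simp [tgt],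
      by simp [tgt, run_empty]⟩
    intro v hv
    exact ⟨0, by simpa using hv⟩

lemma exists_last (D : Finset (Fin n)) (h : D.Nonempty) :
    ∃ m D', D = insert m D' ∧ (∀ j ∈ D', j < m) ∧ #D = #D' + 1 := by
  refine ⟨D.max' h, D.erase (D.max' h), (insert_erase (D.max'_mem h)).symm, ?_,
    (card_erase_add_one (D.max'_mem h)).symm⟩
  intro j hj
  exact lt_of_le_of_ne (D.le_max' j (mem_of_mem_erase hj)) (ne_of_mem_erase hj)

theorem count (d : Fin n) (N : ℕ) : ∀ (c : Bool) (V D : Finset (Fin n)), #V = N →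
    #D + ec c = #V → (#(S d c V D) : ℚ) = W c #V := by
  induction N using Nat.strong_induction_on with
  | _ N ih =>
    have IH : ∀ V : Finset (Fin n), #V = N → ∀ (c' : Bool) (V' D' : Finset (Fin n)),
        #V' < #V → #D' + ec c' = #V' → (#(S d c' V' D') : ℚ) = W c' #V' :=
      fun V hV c' V' D' h1 h2 => ih #V' (by omega) c' V' D' rfl h2
    have hfalse : ∀ V D : Finset (Fin n), #V = N → #D + ec false = #V →
        (#(S d false V D) : ℚ) = W false #V := by
      intro V D hV hD
      rcases D.eq_empty_or_nonempty with rfl | hne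
      · have h1 : #V = 1 := by simpa [ec] using hD.symm
        rw [S_one d V h1, h1]
        simp [W, yc]
      · obtain ⟨m, D', rfl, hm, hc⟩ := exists_last D hne
        rw [card_S d false V D' m hm]
        push_cast
        rw [sum_eq d false V D' (by omega) (IH V hV)]
        have h2 : 2 ≤ #V := by simp [ec] at hD; omega
        have := yc_rec #V h2
        simp only [W, K, sq, ec, Bool.false_eq_true, if_false]
        rw [this, show #V - 1 - 1 = #V - 2 by omega]
        simp
    intro c V D hV hD
    cases c
    · exact hfalse V D hV hD
    · rcases D.eq_empty_or_nonempty with rfl | hne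
      · have h1 : #V = 0 := by simpa [ec] using hD.symm
        rw [h1, W_zero]
        have : S d true V ∅ = ∅ := by
          rw [eq_empty_iff_forall_notMem]
          intro x hx
          have := (mem_S.1 hx).r_mem
          rw [card_eq_zero.1 h1] at this
          simp at this
        simp [this]
      · obtain ⟨m, D', rfl, hm, hc⟩ := exists_last D hne
        rw [card_S d true V D' m hm]
        push_cast
        have hD' : #D' + 1 = #V := by simp only [ec, if_true] at hD; omega
        rw [sum_eq d true V D' (by simp only [ec, if_true]; omega) (IH V hV), if_pos rfl,
          hfalse V D' hV (by simpa [ec] using hD')]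
        obtain ⟨k, hk⟩ : ∃ k, #V = k + 1 := ⟨#V - 1, by omega⟩
        rw [hk]
        simp only [W, K, sq, ec, Bool.false_eq_true, if_false, if_true, Nat.add_sub_cancel,
          Nat.sub_zero]
        rw [gc_rec (k + 1), Nat.factorial_succ]
        push_cast
        ring

lemma isS_univ_iff (d r : Fin n) (p s : Fin n → Fin n) :
    IsRootedTree r p ∧ IsTreePF p s ↔ IsS d true univ univ r p s := by
  rw [isTreePF_iff]
  constructor
  · rintro ⟨⟨h1, h2⟩, h3⟩
    refine ⟨mem_univ _, h1, by simp, by simp, ?_, by simp, by simp, by simp [tgt], ?_⟩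
    · intro v _
      obtain ⟨k, _, hk⟩ := h2 v
      exact ⟨k, hk⟩
    · simpa [tgt] using h3
  · intro h
    refine ⟨⟨h.p_r, ?_⟩, by simpa [tgt] using h.park⟩
    intro v
    obtain ⟨k, hk, h1, _⟩ := exists_short (h.tree v (mem_univ _))
    exact ⟨k, by simpa using hk, h1⟩

end TPF

/-- The total number of pairs `(T, s)` of a rooted labeled tree on
`[n]` (encoded by its root and parent function) together with a parking function `s`
on `T` equals `((n-1)!)² · Σ_{i=0}^{n-1} (n-i)·(2n)^i / i!`. -/
theorem card_tree_parking_functions (n : ℕ) (hn : 1 ≤ n) :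
    (Fintype.card {x : Fin n × (Fin n → Fin n) × (Fin n → Fin n) //
        IsRootedTree x.1 x.2.1 ∧ IsTreePF x.2.1 x.2.2} : ℚ) =
      (Nat.factorial (n - 1) : ℚ) ^ 2 *
        ∑ i ∈ Finset.range n, ((n - i : ℕ) : ℚ) * (2 * n) ^ i / (Nat.factorial i) := by
  have d : Fin n := ⟨0, hn⟩
  rw [← TPF.gc_formula n hn]
  have h := TPF.count d n true Finset.univ Finset.univ (by simp) (by simp [TPF.ec])
  have h2 : Fintype.card {x : Fin n × (Fin n → Fin n) × (Fin n → Fin n) //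
        IsRootedTree x.1 x.2.1 ∧ IsTreePF x.2.1 x.2.2} =
      (TPF.S d true Finset.univ Finset.univ).card := by
    rw [Fintype.card_subtype]
    congr 1
    ext x
    rw [TPF.mem_S, Finset.mem_filter, TPF.isS_univ_iff d]
    simp
  rw [h2, h]
  simp [TPF.W]
end
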